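/- arXiv:1505.03373 — 13 statements merged into one kernel-verified Lean document; each statement's English description precedes it below -/
import Mathlib

section
/- Let H be the Hermitian adjacency matrix of a mixed graph on a finite vertex type V, let s : V → ℂ satisfy s v ∈ {1, -1, I, -I} for every v, and define H' : Matrix V V ℂ by H' u v = conj (s u) * H u v * s v (i.e. H' = S⁻¹HS for the diagonal matrix S with diagonal s). If every entry of H' lies in {0, 1, I, -I} (this condition is exactly admissibility of the partition of V given by the values of s), then H' is again the Hermitian adjacency matrix of a mixed graph (Hermitian, zero diagonal, entries in {0, 1, I, -I}) and H' has the same characteristic polynomial as H; that is, the four-way switching produces a cospectral mixed graph. -/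
open Complex

/-- `H` is the Hermitian adjacency matrix of a mixed graph: Hermitian, zero diagonal,
entries in `{0, 1, I, -I}`. -/
def IsHermAdj {V : Type*} [Fintype V] (H : Matrix V V ℂ) : Prop :=
  H.IsHermitian ∧ (∀ v, H v v = 0) ∧
    ∀ u v, H u v ∈ ({0, 1, Complex.I, -Complex.I} : Set ℂ)

theorem Matrix.charpoly_mul_mul_of_mul_eq_one {n R : Type*} [CommRing R] [Fintype n]
    [DecidableEq n] {P Q : Matrix n n R} (h : P * Q = 1) (A : Matrix n n R) :
    (Q * A * P).charpoly = A.charpoly := by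
  rw [Matrix.charpoly_mul_comm, ← Matrix.mul_assoc, h, Matrix.one_mul]

theorem stmt0 {V : Type*} [Fintype V] [DecidableEq V]
    (H : Matrix V V ℂ) (hH : IsHermAdj H)
    (s : V → ℂ) (hs : ∀ v, s v ∈ ({1, -1, Complex.I, -Complex.I} : Set ℂ))
    (H' : Matrix V V ℂ)
    (hH' : ∀ u v, H' u v = (starRingEnd ℂ) (s u) * H u v * s v)
    (hadm : ∀ u v, H' u v ∈ ({0, 1, Complex.I, -Complex.I} : Set ℂ)) :
    IsHermAdj H' ∧ H'.charpoly = H.charpoly := by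
  obtain ⟨hherm, hdiag, -⟩ := hH
  refine ⟨⟨?_, fun v => by simp [hH', hdiag], hadm⟩, ?_⟩
  · ext u v
    rw [Matrix.conjTranspose_apply, hH', hH', ← hherm.apply u v]
    simp only [star_def, map_mul, conj_conj]
    ring
  · have hfactor : H' = Matrix.diagonal (fun v => starRingEnd ℂ (s v)) * H * Matrix.diagonal s := by
      ext u v
      rw [Matrix.mul_diagonal, Matrix.diagonal_mul, hH']
    have hunit : Matrix.diagonal s * Matrix.diagonal (fun v => starRingEnd ℂ (s v)) = 1 := by
      rw [Matrix.diagonal_mul_diagonal, Matrix.diagonal_eq_one]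
      ext v
      rcases hs v with h | h | h | (h : s v = -I) <;> simp [h]
    rw [hfactor, Matrix.charpoly_mul_mul_of_mul_eq_one hunit]
end

section
/- Let F be a simple graph on a finite vertex type V that is a forest (F is acyclic), and let H : Matrix V V ℂ be Hermitian with zero diagonal such that H u v ∈ {1, I, -I} whenever F.Adj u v and H u v = 0 whenever u ≠ v and ¬F.Adj u v (i.e., H is the Hermitian adjacency matrix of an arbitrary mixed graph whose underlying graph is F). Then the characteristic polynomial of H equals the characteristic polynomial of the adjacency matrix of F (over ℂ); in particular every mixed graph based on a forest is cospectral with the forest itself. -/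
open Complex

/-- On a forest every gain function with values in a group is switching equivalent to the trivial
one. -/
theorem SimpleGraph.IsAcyclic.exists_potential {V M : Type*} [Group M] {F : SimpleGraph V}
    (hF : F.IsAcyclic) (g : V → V → M) (hg : ∀ u v, F.Adj u v → g u v * g v u = 1) :
    ∃ d : V → M, ∀ u v, F.Adj u v → d v = d u * g u v := by
  classical
  let gain : ∀ {r v : V}, F.Walk r v → M := fun p ↦ (p.darts.map fun e ↦ g e.fst e.snd).prod
  have gain_concat : ∀ {r u v : V} (p : F.Walk r u) (h : F.Adj u v),
      gain (p.concat h) = gain p * g u v := by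
    intro r u v p h
    simp [gain, SimpleGraph.Walk.darts_concat]
  have gain_adj : ∀ {r u v : V} (p : F.Walk r u) (q : F.Walk r v), p.IsPath → q.IsPath →
      F.Adj u v → gain q = gain p * g u v := by
    intro r u v p q hp hq h
    by_cases hu : u ∈ q.support
    · rw [hF.path_concat hp hq h hu, gain_concat]
    · have hv := hF.mem_support_of_ne_mem_support_of_adj_of_isPath hp hq h hu
      rw [hF.path_concat hq hp h.symm hv, gain_concat, mul_assoc, hg v u h.symm, mul_one]
  let root : V → V := fun v ↦ (F.connectedComponentMk v).out
  have hroot : ∀ v, F.Reachable (root v) v := fun v ↦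
    SimpleGraph.ConnectedComponent.exact (Quot.out_eq (F.connectedComponentMk v))
  choose p hp using fun v ↦ (hroot v).exists_isPath
  refine ⟨fun v ↦ gain (p v), fun u v h ↦ ?_⟩
  have hr : root v = root u := by
    simp only [root, SimpleGraph.ConnectedComponent.sound h.reachable]
  have key : gain ((p v).copy hr rfl) = gain (p v) := by simp [gain]
  exact key.symm.trans (gain_adj _ _ (hp u) (by simpa using hp v) h)

/-- Conjugating by an invertible diagonal matrix preserves the characteristic polynomial. -/
theorem Matrix.charpoly_of_units_mul_mul_inv {n R : Type*} [Fintype n] [DecidableEq n]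
    [CommRing R] (d : n → Rˣ) (A : Matrix n n R) :
    (Matrix.of fun i j ↦ (d i : R) * A i j * ((d j)⁻¹ : Rˣ)).charpoly = A.charpoly := by
  let D : (Matrix n n R)ˣ :=
    ⟨Matrix.diagonal fun i ↦ (d i : R), Matrix.diagonal fun i ↦ ((d i)⁻¹ : Rˣ),
      by simp, by simp⟩
  rw [← Matrix.charpoly_units_conj D A, ← Matrix.coe_units_inv]
  congr 1
  ext i j
  change _ = (Matrix.diagonal (fun i ↦ (d i : R)) * A *
    Matrix.diagonal fun i ↦ (((d i)⁻¹ : Rˣ) : R)) i j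
  rw [Matrix.mul_diagonal, Matrix.diagonal_mul, Matrix.of_apply]

theorem stmt2 {V : Type*} [Fintype V] [DecidableEq V]
    (F : SimpleGraph V) [DecidableRel F.Adj] (hF : F.IsAcyclic)
    (H : Matrix V V ℂ) (hHerm : H.IsHermitian) (hdiag : ∀ v, H v v = 0)
    (hadj : ∀ u v, F.Adj u v → H u v ∈ ({1, Complex.I, -Complex.I} : Set ℂ))
    (hnon : ∀ u v, u ≠ v → ¬ F.Adj u v → H u v = 0) :
    H.charpoly = (F.adjMatrix ℂ).charpoly := by
  have hmul : ∀ u v, F.Adj u v → H u v * H v u = 1 := by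
    intro u v h
    rw [← hHerm.apply v u]
    obtain h | h | h : H u v = 1 ∨ H u v = I ∨ H u v = -I := hadj u v h <;> simp [h]
  let g : V → V → ℂˣ := fun u v ↦ if h : H u v = 0 then 1 else Units.mk0 (H u v) h
  have hg : ∀ u v, F.Adj u v → (g u v : ℂ) = H u v := by
    intro u v h
    simp [g, left_ne_zero_of_mul_eq_one (hmul u v h)]
  obtain ⟨d, hd⟩ := hF.exists_potential g fun u v h ↦
    Units.ext (by rw [Units.val_mul, hg u v h, hg v u h.symm, hmul u v h, Units.val_one])
  rw [← Matrix.charpoly_of_units_mul_mul_inv d H]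
  congr 1
  ext u v
  rw [Matrix.of_apply, SimpleGraph.adjMatrix_apply]
  split_ifs with h
  · rw [← hg u v h, ← Units.val_mul, ← hd u v h, Units.mul_inv]
  · have h0 : H u v = 0 := by
      rcases eq_or_ne u v with rfl | huv
      · exact hdiag u
      · exact hnon u v huv h
    simp [h0]
end

section
/- Let A : Matrix V V ℕ be symmetric (A u v = A v u), encoding a connected undirected multigraph G (loops and multiple edges allowed): assume the simple graph on V with u ~ v iff u ≠ v and A u v ≠ 0 is connected. Let H : Matrix V V ℂ be Hermitian such that for all u, v there exist k₀ k₁ : ℕ with k₀ + k₁ ≤ A u v and (H u v = k₀ + k₁ * I or H u v = k₀ - k₁ * I), with k₁ = 0 when u = v (so H encodes a mixed multigraph obtained from G by deleting some edges and orienting some non-loop edges without creating digons). Then the following are equivalent: (a) the characteristic polynomial of H equals the characteristic polynomial of A (cast to ℂ); (b) the largest eigenvalue of H equals the largest eigenvalue of A; (c) there exists s : V → ℂ with s v ∈ {1, -1, I, -I} for all v such that H u v = s u * conj (s v) * (A u v : ℂ) for all u, v (in particular no edge has been deleted and H is switching equivalent to A). -/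
open Complex

open scoped ComplexOrder in
/-- A Hermitian matrix is dominated by its largest eigenvalue times the identity. -/
theorem Matrix.IsHermitian.posSemidef_iSup_eigenvalues_smul_one_sub {n : Type*} [Fintype n]
    [DecidableEq n] {A : Matrix n n ℂ} (hA : A.IsHermitian) :
    (((⨆ i, hA.eigenvalues i : ℝ) : ℂ) • (1 : Matrix n n ℂ) - A).PosSemidef := by
  set l : ℝ := ⨆ i, hA.eigenvalues i with hl
  set U : Matrix n n ℂ := (hA.eigenvectorUnitary : Matrix n n ℂ) with hU
  have hUU : U * U.conjTranspose = 1 := Unitary.coe_mul_star_self hA.eigenvectorUnitary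
  have hspec : A = U * Matrix.diagonal (RCLike.ofReal ∘ hA.eigenvalues) * U.conjTranspose :=
    hA.spectral_theorem
  have hpos : (Matrix.diagonal (fun i => ((l - hA.eigenvalues i : ℝ) : ℂ))).PosSemidef := by
    rw [Matrix.posSemidef_diagonal_iff]
    intro i
    have : hA.eigenvalues i ≤ l := le_ciSup (Set.finite_range _).bddAbove i
    exact_mod_cast sub_nonneg.2 this
  have hdiag : Matrix.diagonal (fun i => ((l - hA.eigenvalues i : ℝ) : ℂ)) =
      (l : ℂ) • (1 : Matrix n n ℂ) - Matrix.diagonal (RCLike.ofReal ∘ hA.eigenvalues) := by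
    rw [Matrix.smul_one_eq_diagonal, Matrix.diagonal_sub]
    congr 1
    ext i
    simp
  convert hpos.mul_mul_conjTranspose_same U using 1
  rw [hdiag, Matrix.mul_sub, Matrix.sub_mul, ← hspec, Matrix.mul_smul, Matrix.mul_one,
    Matrix.smul_mul, hUU]

/-- A predicate stable under adjacency holds everywhere on a connected multigraph as soon as it
holds somewhere. -/
theorem SimpleGraph.Connected.forall_of_fromRel {V : Type*} {r : V → V → Prop}
    (hr : ∀ u v, r u v → r v u) (h : (SimpleGraph.fromRel r).Connected) {P : V → Prop}
    (hP : ∀ u v, r u v → P u → P v) {a : V} (ha : P a) (b : V) : P b := by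
  obtain ⟨p⟩ := h.preconnected a b
  induction p with
  | nil => exact ha
  | cons hadj _ ih =>
    rw [SimpleGraph.fromRel_adj] at hadj
    exact ih (hP _ _ (hadj.2.elim id (hr _ _)) ha)

/-- If `conj p * z * q` has real part at least `a * ‖p‖ * ‖q‖` while `‖z‖ ≤ a`, then `z` is `a`
times the ratio of the phases of `p` and `q`. -/
theorem Complex.eq_phase_mul_of_le_re {p q z : ℂ} {a : ℝ} (hp : p ≠ 0) (hq : q ≠ 0)
    (hz : ‖z‖ ≤ a) (h : a * ‖p‖ * ‖q‖ ≤ (starRingEnd ℂ p * z * q).re) :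
    z = (p / ‖p‖) * starRingEnd ℂ (q / ‖q‖) * a := by
  have hp' : 0 < ‖p‖ := norm_pos_iff.2 hp
  have hq' : 0 < ‖q‖ := norm_pos_iff.2 hq
  have hle : ‖starRingEnd ℂ p * z * q‖ ≤ a * ‖p‖ * ‖q‖ := by
    rw [norm_mul, norm_mul, RCLike.norm_conj, mul_comm ‖p‖]
    gcongr
  have hre : (starRingEnd ℂ p * z * q).re = ‖starRingEnd ℂ p * z * q‖ :=
    le_antisymm (Complex.re_le_norm _) (hle.trans h)
  have him : (starRingEnd ℂ p * z * q).im = 0 := by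
    rw [← Complex.abs_re_eq_norm, abs_of_nonneg (hre ▸ norm_nonneg _), hre]
  have heq : starRingEnd ℂ p * z * q = ((a * ‖p‖ * ‖q‖ : ℝ) : ℂ) := by
    apply Complex.ext
    · rw [Complex.ofReal_re]
      exact le_antisymm (hre.le.trans hle) h
    · rw [him, Complex.ofReal_im]
  have hpC : (‖p‖ : ℂ) ≠ 0 := by exact_mod_cast hp'.ne'
  have hqC : (‖q‖ : ℂ) ≠ 0 := by exact_mod_cast hq'.ne'
  have hpp : p * starRingEnd ℂ p = (‖p‖ : ℂ) ^ 2 := Complex.mul_conj' p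
  have hqq : q * starRingEnd ℂ q = (‖q‖ : ℂ) ^ 2 := Complex.mul_conj' q
  rw [map_div₀, Complex.conj_ofReal]
  field_simp
  apply mul_left_cancel₀ (mul_ne_zero hpC hqC)
  push_cast at heq
  linear_combination p * starRingEnd ℂ q * heq - z * q * starRingEnd ℂ q * hpp
    - z * (‖p‖ : ℂ) ^ 2 * hqq

/-- The norm of a mixed multigraph entry is at most the number of edges used. -/
theorem Complex.norm_natCast_add_mul_I_le {k₀ k₁ a : ℕ} (hk : k₀ + k₁ ≤ a) {z : ℂ}
    (hz : z = (k₀ : ℂ) + (k₁ : ℂ) * Complex.I ∨ z = (k₀ : ℂ) - (k₁ : ℂ) * Complex.I) :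
    ‖z‖ ≤ a := by
  have hb : ‖(k₀ : ℂ)‖ + ‖(k₁ : ℂ) * Complex.I‖ ≤ a := by
    simp only [norm_mul, Complex.norm_I, mul_one, Complex.norm_natCast]
    exact_mod_cast hk
  rcases hz with rfl | rfl
  · exact (norm_add_le _ _).trans hb
  · exact (norm_sub_le _ _).trans hb

/-- A mixed multigraph entry of the largest possible norm consists of parallel edges of a single
type. -/
theorem Complex.mem_of_natCast_add_mul_I_eq {k₀ k₁ a : ℕ} (hk : k₀ + k₁ ≤ a) (ha : a ≠ 0) {z w : ℂ}
    (hz : z = (k₀ : ℂ) + (k₁ : ℂ) * Complex.I ∨ z = (k₀ : ℂ) - (k₁ : ℂ) * Complex.I)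
    (hw : ‖w‖ = 1) (hzw : z = w * a) : w ∈ ({1, Complex.I, -Complex.I} : Set ℂ) := by
  have hsq : Complex.normSq z = (k₀ : ℝ) ^ 2 + (k₁ : ℝ) ^ 2 := by
    rcases hz with rfl | rfl <;> simp [Complex.normSq_apply] <;> ring
  have hsq' : Complex.normSq z = (a : ℝ) ^ 2 := by
    rw [hzw, Complex.normSq_eq_norm_sq, norm_mul, hw, Complex.norm_natCast, one_mul]
  have hN : k₀ ^ 2 + k₁ ^ 2 = a ^ 2 := by exact_mod_cast hsq.symm.trans hsq'
  have hprod : k₀ * k₁ = 0 := by nlinarith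
  have haC : (a : ℂ) ≠ 0 := by exact_mod_cast ha
  rcases Nat.mul_eq_zero.1 hprod with rfl | rfl
  · obtain rfl : k₁ = a := by nlinarith
    rcases hz with h | h
    · right; left
      apply mul_right_cancel₀ haC
      rw [← hzw, h]; push_cast; ring
    · right; right
      apply mul_right_cancel₀ haC
      rw [← hzw, h]; push_cast; ring
  · obtain rfl : k₀ = a := by nlinarith
    left
    apply mul_right_cancel₀ haC
    rw [← hzw]
    rcases hz with h | h <;> rw [h] <;> push_cast <;> ring

/-- Conjugation by a diagonal matrix of phases preserves the characteristic polynomial. -/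
theorem Matrix.charpoly_eq_of_switching {n : Type*} [Fintype n] [DecidableEq n]
    {M N : Matrix n n ℂ} {s : n → ℂ} (hs : ∀ i, starRingEnd ℂ (s i) * s i = 1)
    (h : ∀ i j, M i j = s i * starRingEnd ℂ (s j) * N i j) : M.charpoly = N.charpoly := by
  have hM : M = Matrix.diagonal s * (N * Matrix.diagonal (fun i => starRingEnd ℂ (s i))) := by
    ext i j
    rw [Matrix.diagonal_mul, Matrix.mul_diagonal, h]
    ring
  rw [hM, Matrix.charpoly_mul_comm, Matrix.mul_assoc, Matrix.diagonal_mul_diagonal]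
  simp [hs]

/-- Equality case of the diamagnetic inequality: if `H` is dominated entrywise by the adjacency
matrix of a connected multigraph and has the same largest eigenvalue, then it arises from it by a
diagonal unitary conjugation. -/
theorem Matrix.exists_phase_of_iSup_eigenvalues_eq {V : Type*} [Fintype V] [DecidableEq V]
    {A : Matrix V V ℕ} (hAsymm : ∀ u v, A u v = A v u)
    (hconn : (SimpleGraph.fromRel (fun u v => A u v ≠ 0)).Connected)
    {H : Matrix V V ℂ} (hHerm : H.IsHermitian) (hle : ∀ u v, ‖H u v‖ ≤ A u v)
    (hAHerm : (A.map (fun k => (k : ℂ))).IsHermitian)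
    (hsup : (⨆ i, hHerm.eigenvalues i) = ⨆ i, hAHerm.eigenvalues i) :
    ∃ t : V → ℂ, (∀ v, ‖t v‖ = 1) ∧
      ∀ u v, H u v = t u * starRingEnd ℂ (t v) * (A u v : ℂ) := by
  have := hconn.nonempty
  set B : Matrix V V ℂ := A.map (fun k => (k : ℂ)) with hB
  obtain ⟨i, hi⟩ := exists_eq_ciSup_of_finite (f := hHerm.eigenvalues)
  set l : ℝ := ⨆ i, hAHerm.eigenvalues i with hl
  set x : V → ℂ := (hHerm.eigenvectorBasis i).ofLp with hx
  have hx0 : ∃ v, x v ≠ 0 := by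
    by_contra! h0
    apply (hHerm.eigenvectorBasis.orthonormal.ne_zero i)
    ext v
    exact h0 v
  have hHx : ∀ u, ∑ v, H u v * x v = l * x u := by
    intro u
    have := congrFun (hHerm.mulVec_eigenvectorBasis i) u
    rw [hi, hsup] at this
    simpa [Matrix.mulVec, dotProduct, hx] using this
  set y : V → ℂ := fun v => (‖x v‖ : ℂ) with hy
  have hpsd := hAHerm.posSemidef_iSup_eigenvalues_smul_one_sub
  rw [← hl] at hpsd
  have hquad : star y ⬝ᵥ ((l : ℂ) • (1 : Matrix V V ℂ) - B).mulVec y =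
      ((l * ∑ u, ‖x u‖ ^ 2 - ∑ u, ∑ v, A u v * ‖x u‖ * ‖x v‖ : ℝ) : ℂ) := by
    rw [Matrix.sub_mulVec, dotProduct_sub, Matrix.smul_mulVec, Matrix.one_mulVec]
    simp only [Matrix.mulVec, dotProduct, hB, hy, Matrix.map_apply, Pi.star_apply, Pi.smul_apply,
      smul_eq_mul, RCLike.star_def, Complex.conj_ofReal, Finset.mul_sum]
    push_cast
    congr 1
    · exact Finset.sum_congr rfl fun u _ => by ring
    · exact Finset.sum_congr rfl fun u _ => Finset.sum_congr rfl fun v _ => by ring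
  have hHquad : l * ∑ u, ‖x u‖ ^ 2 =
      ∑ u, ∑ v, (starRingEnd ℂ (x u) * H u v * x v).re := by
    have : ((l * ∑ u, ‖x u‖ ^ 2 : ℝ) : ℂ) = ∑ u, ∑ v, starRingEnd ℂ (x u) * H u v * x v := by
      push_cast
      rw [Finset.mul_sum]
      refine Finset.sum_congr rfl fun u _ => ?_
      simp only [mul_assoc]
      rw [← Finset.mul_sum, hHx, ← Complex.mul_conj']
      ring
    simpa only [Complex.ofReal_re, Complex.re_sum] using congrArg Complex.re this
  have hterm : ∀ u v, (starRingEnd ℂ (x u) * H u v * x v).re ≤ A u v * ‖x u‖ * ‖x v‖ := by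
    intro u v
    refine (Complex.re_le_norm _).trans ?_
    rw [norm_mul, norm_mul, RCLike.norm_conj, mul_comm ‖x u‖]
    gcongr
    exact hle u v
  have hsum_le : ∑ u, ∑ v, (starRingEnd ℂ (x u) * H u v * x v).re ≤
      ∑ u, ∑ v, A u v * ‖x u‖ * ‖x v‖ :=
    Finset.sum_le_sum fun u _ => Finset.sum_le_sum fun v _ => hterm u v
  have hnonneg : 0 ≤ l * ∑ u, ‖x u‖ ^ 2 - ∑ u, ∑ v, A u v * ‖x u‖ * ‖x v‖ := by
    have := hpsd.re_dotProduct_nonneg y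
    rw [hquad] at this
    simpa only [RCLike.re_eq_complex_re, Complex.ofReal_re] using this
  have hsum_eq : ∑ u, ∑ v, (starRingEnd ℂ (x u) * H u v * x v).re =
      ∑ u, ∑ v, A u v * ‖x u‖ * ‖x v‖ := by linarith
  have hterm_eq : ∀ u v, (starRingEnd ℂ (x u) * H u v * x v).re = A u v * ‖x u‖ * ‖x v‖ := by
    intro u v
    have h1 := (Finset.sum_eq_sum_iff_of_le fun u _ =>
      Finset.sum_le_sum fun v _ => hterm u v).1 hsum_eq u (Finset.mem_univ _)
    exact (Finset.sum_eq_sum_iff_of_le fun v _ => hterm u v).1 h1 v (Finset.mem_univ _)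
  have hker : ((l : ℂ) • (1 : Matrix V V ℂ) - B).mulVec y = 0 := by
    rw [← hpsd.dotProduct_mulVec_zero_iff, hquad, ← hsum_eq, ← hHquad, sub_self,
      Complex.ofReal_zero]
  have hAy : ∀ u, ∑ v, (A u v : ℝ) * ‖x v‖ = l * ‖x u‖ := by
    intro u
    have := congrFun hker u
    rw [Matrix.sub_mulVec, Matrix.smul_mulVec, Matrix.one_mulVec, Pi.sub_apply, Pi.zero_apply,
      sub_eq_zero] at this
    simp only [Matrix.mulVec, dotProduct, hB, hy, Matrix.map_apply, Pi.smul_apply,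
      smul_eq_mul] at this
    exact_mod_cast this.symm
  have hxne : ∀ v, x v ≠ 0 := by
    obtain ⟨a, ha⟩ := hx0
    refine hconn.forall_of_fromRel (fun u v h => by rwa [hAsymm v u]) (P := fun v => x v ≠ 0) ?_ ha
    intro u v huv hu hv
    have h0 := hAy v
    rw [hv, norm_zero, mul_zero, Finset.sum_eq_zero_iff_of_nonneg fun _ _ => by positivity] at h0
    have := h0 u (Finset.mem_univ _)
    rw [hAsymm v u] at this
    simp [huv, hu] at this
  refine ⟨fun v => x v / ‖x v‖, fun v => ?_, fun u v => ?_⟩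
  · simp [hxne v]
  · exact_mod_cast
      Complex.eq_phase_mul_of_le_re (hxne u) (hxne v) (hle u v) (hterm_eq u v).ge

/-- A mixed multigraph whose largest eigenvalue is that of the underlying connected multigraph is
switching equivalent to it. -/
theorem exists_switching_of_iSup_eigenvalues_eq {V : Type*} [Fintype V] [DecidableEq V]
    {A : Matrix V V ℕ} (hAsymm : ∀ u v, A u v = A v u)
    (hconn : (SimpleGraph.fromRel (fun u v => A u v ≠ 0)).Connected)
    {H : Matrix V V ℂ} (hHerm : H.IsHermitian)
    (hmixed : ∀ u v, ∃ k₀ k₁ : ℕ, k₀ + k₁ ≤ A u v ∧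
      (H u v = (k₀ : ℂ) + (k₁ : ℂ) * Complex.I ∨ H u v = (k₀ : ℂ) - (k₁ : ℂ) * Complex.I))
    (hAHerm : (A.map (fun k => (k : ℂ))).IsHermitian)
    (hsup : (⨆ i, hHerm.eigenvalues i) = ⨆ i, hAHerm.eigenvalues i) :
    ∃ s : V → ℂ, (∀ v, s v ∈ ({1, -1, Complex.I, -Complex.I} : Set ℂ)) ∧
      ∀ u v, H u v = s u * (starRingEnd ℂ) (s v) * (A u v : ℂ) := by
  have hle : ∀ u v, ‖H u v‖ ≤ A u v := fun u v => by
    obtain ⟨k₀, k₁, hk, hz⟩ := hmixed u v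
    exact Complex.norm_natCast_add_mul_I_le hk hz
  obtain ⟨t, ht, hH⟩ :=
    Matrix.exists_phase_of_iSup_eigenvalues_eq hAsymm hconn hHerm hle hAHerm hsup
  have htt : ∀ v, t v * starRingEnd ℂ (t v) = 1 := fun v => by
    rw [Complex.mul_conj', ht]; simp
  obtain ⟨r⟩ := hconn.nonempty
  refine ⟨fun v => t v * starRingEnd ℂ (t r), ?_, fun u v => ?_⟩
  · refine hconn.forall_of_fromRel (fun u v h => by rwa [hAsymm v u]) ?_ (a := r) ?_
    · intro u v huv hu
      obtain ⟨k₀, k₁, hk, hz⟩ := hmixed v u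
      have hw : t v * starRingEnd ℂ (t u) ∈ ({1, Complex.I, -Complex.I} : Set ℂ) :=
        Complex.mem_of_natCast_add_mul_I_eq hk (by rwa [hAsymm v u]) hz (by simp [ht]) (hH v u)
      have hmul : t v * starRingEnd ℂ (t r) =
          (t v * starRingEnd ℂ (t u)) * (t u * starRingEnd ℂ (t r)) := by
        linear_combination -(t v * starRingEnd ℂ (t r)) * htt u
      simp only [Set.mem_insert_iff, Set.mem_singleton_iff] at hu hw ⊢
      rw [hmul]
      rcases hw with h | h | h <;> rcases hu with h' | h' | h' | h' <;> rw [h, h'] <;> simp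
    · simp [htt]
  · rw [hH, map_mul, Complex.conj_conj]
    linear_combination -(t u * starRingEnd ℂ (t v) * A u v) * htt r

theorem stmt3 {V : Type*} [Fintype V] [DecidableEq V]
    (A : Matrix V V ℕ) (hAsymm : ∀ u v, A u v = A v u)
    (hconn : (SimpleGraph.fromRel (fun u v => A u v ≠ 0)).Connected)
    (H : Matrix V V ℂ) (hHerm : H.IsHermitian)
    (hmixed : ∀ u v, ∃ k₀ k₁ : ℕ, k₀ + k₁ ≤ A u v ∧
      (H u v = (k₀ : ℂ) + (k₁ : ℂ) * Complex.I ∨ H u v = (k₀ : ℂ) - (k₁ : ℂ) * Complex.I) ∧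
      (u = v → k₁ = 0))
    (hAHerm : (A.map (fun k => (k : ℂ))).IsHermitian) :
    (H.charpoly = (A.map (fun k => (k : ℂ))).charpoly ↔
      ∃ s : V → ℂ, (∀ v, s v ∈ ({1, -1, Complex.I, -Complex.I} : Set ℂ)) ∧
        ∀ u v, H u v = s u * (starRingEnd ℂ) (s v) * (A u v : ℂ)) ∧
    ((⨆ i, hHerm.eigenvalues i) = (⨆ i, hAHerm.eigenvalues i) ↔
      ∃ s : V → ℂ, (∀ v, s v ∈ ({1, -1, Complex.I, -Complex.I} : Set ℂ)) ∧
        ∀ u v, H u v = s u * (starRingEnd ℂ) (s v) * (A u v : ℂ)) := by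
  have hswitch : (∃ s : V → ℂ, (∀ v, s v ∈ ({1, -1, Complex.I, -Complex.I} : Set ℂ)) ∧
      ∀ u v, H u v = s u * (starRingEnd ℂ) (s v) * (A u v : ℂ)) →
      H.charpoly = (A.map (fun k => (k : ℂ))).charpoly := by
    rintro ⟨s, hs, h⟩
    refine Matrix.charpoly_eq_of_switching (s := s) (fun v => ?_) h
    rcases hs v with h | h | h | h <;> rw [h] <;> simp
  have hsup : H.charpoly = (A.map (fun k => (k : ℂ))).charpoly →
      (⨆ i, hHerm.eigenvalues i) = ⨆ i, hAHerm.eigenvalues i := fun h => by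
    rw [(hHerm.eigenvalues_eq_eigenvalues_iff hAHerm).2 h]
  have hex := exists_switching_of_iSup_eigenvalues_eq hAsymm hconn hHerm
    (fun u v => by
      obtain ⟨k₀, k₁, hk, hz, -⟩ := hmixed u v
      exact ⟨k₀, k₁, hk, hz⟩) hAHerm
  exact ⟨⟨fun h => hex (hsup h), hswitch⟩, ⟨hex, fun h => hsup (hswitch h)⟩⟩
end

section
/- Let A : Matrix V V ℕ be symmetric (A u v = A v u), encoding a connected undirected multigraph G (loops and multiple edges allowed): assume the simple graph on V with u ~ v iff u ≠ v and A u v ≠ 0 is connected. Let H : Matrix V V ℂ be Hermitian such that for all u, v there exist k₀ k₁ : ℕ with k₀ + k₁ ≤ A u v and (H u v = k₀ + k₁ * I or H u v = k₀ - k₁ * I), with k₁ = 0 when u = v. Then the following are equivalent: (a) the characteristic polynomial of -H equals the characteristic polynomial of A (cast to ℂ), i.e. H and A are H-antispectral; (b) the smallest eigenvalue of H equals the negative of the largest eigenvalue of A; (c) there exists s : V → ℂ with s v ∈ {1, -1, I, -I} for all v such that H u v = - s u * conj (s v) * (A u v : ℂ) for all u, v. -/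
open Complex
open scoped ComplexOrder

namespace Matrix.IsHermitian

variable {n : Type*} [Fintype n] [DecidableEq n] {B : Matrix n n ℂ}

theorem mem_range_eigenvalues_iff (hB : B.IsHermitian) (μ : ℝ) :
    μ ∈ Set.range hB.eigenvalues ↔ B.charpoly.IsRoot (μ : ℂ) := by
  rw [← Matrix.mem_spectrum_iff_isRoot_charpoly, hB.spectrum_eq_image_range]
  simp

theorem iInf_eigenvalues_eq_neg_iSup_of_charpoly_neg_eq {C : Matrix n n ℂ} (hB : B.IsHermitian)
    (hC : C.IsHermitian) (h : (-B).charpoly = C.charpoly) :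
    ⨅ i, hB.eigenvalues i = -⨆ i, hC.eigenvalues i := by
  have key : -Set.range hB.eigenvalues = Set.range hC.eigenvalues := by
    ext μ
    rw [Set.mem_neg, mem_range_eigenvalues_iff, mem_range_eigenvalues_iff, ← h,
      ← Matrix.mem_spectrum_iff_isRoot_charpoly, ← Matrix.mem_spectrum_iff_isRoot_charpoly,
      ← spectrum.neg_eq, Set.mem_neg]
    simp
  rw [iInf, Real.sInf_def, key, iSup]

theorem posSemidef_iSup_eigenvalues_smul_one_sub_s4 (hB : B.IsHermitian) :
    (((⨆ i, hB.eigenvalues i : ℝ) : ℂ) • (1 : Matrix n n ℂ) - B).PosSemidef := by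
  set ρ : ℝ := ⨆ i, hB.eigenvalues i
  have hM : ((ρ : ℂ) • (1 : Matrix n n ℂ) - B).IsHermitian := by
    refine Matrix.IsHermitian.sub ?_ hB
    simp [Matrix.IsHermitian, Matrix.conjTranspose_smul]
  rw [hM.posSemidef_iff_eigenvalues_nonneg]
  intro i
  have h1 : ((hM.eigenvalues i : ℝ) : ℂ) ∈ spectrum ℂ ((ρ : ℂ) • (1 : Matrix n n ℂ) - B) := by
    rw [hM.spectrum_eq_image_range]
    exact ⟨_, ⟨i, rfl⟩, rfl⟩
  generalize hM.eigenvalues i = μ at h1 ⊢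
  rw [← Algebra.algebraMap_eq_smul_one, ← spectrum.singleton_sub_eq, Set.singleton_sub,
    hB.spectrum_eq_image_range] at h1
  obtain ⟨_, ⟨_, ⟨j, rfl⟩, rfl⟩, h2⟩ := h1
  have h3 : ρ - hB.eigenvalues j = μ := by
    have h2' : (ρ : ℂ) - (hB.eigenvalues j : ℂ) = (μ : ℂ) := h2
    exact_mod_cast h2'
  have h4 : hB.eigenvalues j ≤ ρ := le_ciSup (Set.finite_range _).bddAbove j
  simp only [Pi.zero_apply]
  linarith

end Matrix.IsHermitian

/-- If a finite sum bounded termwise in norm by `g` attains `-∑ g`, every term is extremal. -/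
theorem Complex.eq_neg_of_norm_le_of_sum_eq_neg_sum {ι : Type*} [Fintype ι] {f : ι → ℂ}
    {g : ι → ℝ} (hfg : ∀ i, ‖f i‖ ≤ g i) (h : ∑ i, f i = -((∑ i, g i : ℝ) : ℂ)) (i : ι) :
    f i = -(g i : ℂ) := by
  have hre : ∀ j, 0 ≤ g j + (f j).re := fun j => by
    have := (abs_le.1 ((Complex.abs_re_le_norm (f j)).trans (hfg j))).1
    linarith
  have hsum : ∑ j, (g j + (f j).re) = 0 := by
    have := congrArg Complex.re h
    simp only [Complex.re_sum, Complex.neg_re, Complex.ofReal_re] at this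
    rw [Finset.sum_add_distrib, this, add_neg_cancel]
  have hi := (Finset.sum_eq_zero_iff_of_nonneg fun j _ => hre j).1 hsum i (Finset.mem_univ i)
  have hsq : ‖f i‖ ^ 2 ≤ g i ^ 2 := pow_le_pow_left₀ (norm_nonneg _) (hfg i) 2
  rw [Complex.sq_norm, Complex.normSq_apply] at hsq
  have hfre : (f i).re = -g i := by linarith
  rw [hfre] at hsq
  have him : (f i).im = 0 := by
    have : (f i).im * (f i).im = 0 := le_antisymm (by linarith) (mul_self_nonneg _)
    simpa using this
  apply Complex.ext <;> simp [hfre, him]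

theorem Complex.mem_fourth_roots_iff (z : ℂ) :
    z ∈ ({1, -1, Complex.I, -Complex.I} : Set ℂ) ↔ z ^ 4 = 1 := by
  have h : z ^ 4 - 1 = (z - 1) * (z + 1) * ((z - I) * (z + I)) := by
    linear_combination (z ^ 2 - 1) * Complex.I_sq
  rw [← sub_eq_zero (a := z ^ 4), h]
  simp only [mul_eq_zero, sub_eq_zero, add_eq_zero_iff_eq_neg, Set.mem_insert_iff,
    Set.mem_singleton_iff]
  tauto

/-- The value of `k₀` undirected edges together with `k₁` parallel arcs. -/
theorem Complex.norm_le_of_mixed {z : ℂ} {a k₀ k₁ : ℕ} (hk : k₀ + k₁ ≤ a)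
    (hz : z = (k₀ : ℂ) + (k₁ : ℂ) * I ∨ z = (k₀ : ℂ) - (k₁ : ℂ) * I) : ‖z‖ ≤ a := by
  have hk' : (k₀ : ℝ) + k₁ ≤ a := by exact_mod_cast hk
  have h : ‖z‖ ≤ (k₀ : ℝ) + k₁ := by
    rcases hz with rfl | rfl
    · exact (norm_add_le _ _).trans (by simp)
    · exact (norm_sub_le _ _).trans (by simp)
  exact h.trans hk'

theorem Complex.pow_four_eq_of_mixed {z : ℂ} {a k₀ k₁ : ℕ} (hk : k₀ + k₁ ≤ a)
    (hz : z = (k₀ : ℂ) + (k₁ : ℂ) * I ∨ z = (k₀ : ℂ) - (k₁ : ℂ) * I) (hnorm : ‖z‖ = a) :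
    z ^ 4 = (a : ℂ) ^ 4 := by
  have hsq : (k₀ : ℝ) ^ 2 + (k₁ : ℝ) ^ 2 = (a : ℝ) ^ 2 := by
    rw [← hnorm, Complex.sq_norm, Complex.normSq_apply]
    rcases hz with rfl | rfl <;> simp <;> ring
  have hsqN : k₀ ^ 2 + k₁ ^ 2 = a ^ 2 := by exact_mod_cast hsq
  have h0 : k₀ * k₁ = 0 := by nlinarith [Nat.pow_le_pow_left hk 2]
  rcases Nat.mul_eq_zero.1 h0 with rfl | rfl
  · have : k₁ = a := Nat.pow_left_injective (n := 2) (by norm_num) (by simpa using hsqN)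
    subst this
    rcases hz with rfl | rfl <;> simp [mul_pow, Even.neg_pow (by decide : Even 4)]
  · have : k₀ = a := Nat.pow_left_injective (n := 2) (by norm_num) (by simpa using hsqN)
    subst this
    rcases hz with rfl | rfl <;> simp

/-- A property holding at one vertex and stable along edges holds everywhere. -/
theorem SimpleGraph.Connected.forall_of_adj {V : Type*} {G : SimpleGraph V} (hG : G.Connected)
    {p : V → Prop} (hp : ∀ u v, G.Adj u v → p u → p v) {r : V} (hr : p r) (v : V) : p v := by
  obtain ⟨w⟩ := hG.preconnected r v
  induction w with
  | nil => exact hr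
  | cons h _ ih => exact ih (hp _ _ h hr)

section

variable {V : Type*} [Fintype V] {A : Matrix V V ℕ}

theorem pos_of_connected_of_eigenvector (hAsymm : ∀ u v, A u v = A v u)
    (hconn : (SimpleGraph.fromRel (fun u v => A u v ≠ 0)).Connected) {ρ : ℝ} {y : V → ℝ}
    (hy : ∀ v, 0 ≤ y v) (hy0 : ∃ v, y v ≠ 0) (h : ∀ u, ρ * y u = ∑ v, (A u v : ℝ) * y v)
    (u : V) : 0 < y u := by
  refine (hy u).lt_of_ne' fun hu => ?_
  obtain ⟨w, hw⟩ := hy0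
  refine hw (hconn.forall_of_adj (p := fun v => y v = 0) (fun a b hab ha => ?_) hu w)
  have hAab : A a b ≠ 0 := by
    rw [SimpleGraph.fromRel_adj] at hab
    rcases hab.2 with hA | hA
    · exact hA
    · rwa [hAsymm]
  have hsum := h a
  rw [ha, mul_zero] at hsum
  have := (Finset.sum_eq_zero_iff_of_nonneg fun v _ =>
    mul_nonneg (Nat.cast_nonneg (A a v)) (hy v)).1 hsum.symm b (Finset.mem_univ b)
  simpa [hAab] using this

variable [DecidableEq V]

theorem sum_mul_eq_of_le_of_posSemidef {ρ : ℝ}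
    (hM : ((ρ : ℂ) • (1 : Matrix V V ℂ) - A.map (fun k => (k : ℂ))).PosSemidef) {y : V → ℝ}
    (hy : ∀ v, 0 ≤ y v) (h : ∀ u, ρ * y u ≤ ∑ v, (A u v : ℝ) * y v) (u : V) :
    ρ * y u = ∑ v, (A u v : ℝ) * y v := by
  set M := (ρ : ℂ) • (1 : Matrix V V ℂ) - A.map (fun k => (k : ℂ)) with hMdef
  set x : V → ℂ := fun v => (y v : ℂ)
  have hMx : ∀ u, M.mulVec x u = ((ρ * y u - ∑ v, (A u v : ℝ) * y v : ℝ) : ℂ) := by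
    intro u
    rw [hMdef, Matrix.sub_mulVec, Matrix.smul_mulVec, Matrix.one_mulVec]
    simp [Matrix.mulVec, dotProduct, x]
  have hdot : star x ⬝ᵥ M.mulVec x =
      ((∑ u, y u * (ρ * y u - ∑ v, (A u v : ℝ) * y v) : ℝ) : ℂ) := by
    simp only [dotProduct, hMx]
    simp [x]
  have hnonneg : 0 ≤ ∑ u, y u * (ρ * y u - ∑ v, (A u v : ℝ) * y v) := by
    have := hM.dotProduct_mulVec_nonneg x
    rw [hdot] at this
    exact_mod_cast this
  have hnonpos : ∑ u, y u * (ρ * y u - ∑ v, (A u v : ℝ) * y v) ≤ 0 :=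
    Finset.sum_nonpos fun u _ => mul_nonpos_of_nonneg_of_nonpos (hy u) (sub_nonpos.2 (h u))
  have hzero : M.mulVec x = 0 := by
    rw [← hM.dotProduct_mulVec_zero_iff, hdot, le_antisymm hnonpos hnonneg, Complex.ofReal_zero]
  have := congrFun hzero u
  rw [hMx, Pi.zero_apply, Complex.ofReal_eq_zero, sub_eq_zero] at this
  exact this

theorem exists_switching_of_eigenvector (hAsymm : ∀ u v, A u v = A v u)
    (hconn : (SimpleGraph.fromRel (fun u v => A u v ≠ 0)).Connected) {H : Matrix V V ℂ}
    (hmixed : ∀ u v, ∃ k₀ k₁ : ℕ, k₀ + k₁ ≤ A u v ∧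
      (H u v = (k₀ : ℂ) + (k₁ : ℂ) * I ∨ H u v = (k₀ : ℂ) - (k₁ : ℂ) * I)) {ρ : ℝ}
    (hM : ((ρ : ℂ) • (1 : Matrix V V ℂ) - A.map (fun k => (k : ℂ))).PosSemidef) {x : V → ℂ}
    (hx0 : ∃ v, x v ≠ 0) (hx : ∀ u, ∑ v, H u v * x v = -(ρ : ℂ) * x u) :
    ∃ s : V → ℂ, (∀ v, s v ∈ ({1, -1, I, -I} : Set ℂ)) ∧
      ∀ u v, H u v = - s u * (starRingEnd ℂ) (s v) * (A u v : ℂ) := by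
  have hnorm : ∀ u v, ‖H u v‖ ≤ A u v := fun u v => by
    obtain ⟨k₀, k₁, hk, hz⟩ := hmixed u v
    exact Complex.norm_le_of_mixed hk hz
  have hle : ∀ u, ρ * ‖x u‖ ≤ ∑ v, (A u v : ℝ) * ‖x v‖ := fun u => by
    calc ρ * ‖x u‖ ≤ |ρ| * ‖x u‖ := by gcongr; exact le_abs_self ρ
      _ = ‖∑ v, H u v * x v‖ := by rw [hx]; simp
      _ ≤ ∑ v, ‖H u v * x v‖ := norm_sum_le _ _
      _ ≤ _ := Finset.sum_le_sum fun v _ => by rw [norm_mul]; gcongr; exact hnorm u v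
  have heq := sum_mul_eq_of_le_of_posSemidef hM (fun v => norm_nonneg (x v)) hle
  have hpos := pos_of_connected_of_eigenvector hAsymm hconn (fun v => norm_nonneg (x v))
    (by simpa using hx0) heq
  have hne : ∀ v, (‖x v‖ : ℂ) ≠ 0 := fun v => by exact_mod_cast (hpos v).ne'
  have hentry : ∀ u v, (starRingEnd ℂ) (x u) * (H u v * x v) =
      -((‖x u‖ * ((A u v : ℝ) * ‖x v‖) : ℝ) : ℂ) := fun u => by
    refine Complex.eq_neg_of_norm_le_of_sum_eq_neg_sum (fun v => ?_) ?_
    · rw [norm_mul, norm_mul, Complex.norm_conj]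
      gcongr
      exact hnorm u v
    · rw [← Finset.mul_sum, ← Finset.mul_sum, ← heq, hx]
      push_cast
      linear_combination -(ρ : ℂ) * Complex.conj_mul' (x u)
  set t : V → ℂ := fun v => x v / ‖x v‖ with ht
  have htt : ∀ v, t v * (starRingEnd ℂ) (t v) = 1 := fun v => by
    have := hne v
    simp only [ht, map_div₀, Complex.conj_ofReal]
    field_simp
    exact Complex.mul_conj' _
  have hH : ∀ u v, H u v = -t u * (starRingEnd ℂ) (t v) * (A u v : ℂ) := fun u v => by
    have h1 : (starRingEnd ℂ) (t u) * H u v * t v = -(A u v : ℂ) := by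
      have := hentry u v
      have h2 := hne u
      have h3 := hne v
      push_cast at this
      simp only [ht, map_div₀, Complex.conj_ofReal]
      field_simp
      linear_combination this
    linear_combination (t u * (starRingEnd ℂ) (t v)) * h1
      - H u v * t v * (starRingEnd ℂ) (t v) * htt u - H u v * htt v
  have htnorm : ∀ v, ‖t v‖ = 1 := fun v => by simp [ht, (hpos v).ne']
  have hadj : ∀ u v, A u v ≠ 0 → t u ^ 4 = t v ^ 4 := fun u v hA => by
    obtain ⟨k₀, k₁, hk, hz⟩ := hmixed u v
    have h4 := Complex.pow_four_eq_of_mixed hk hz (by rw [hH]; simp [htnorm])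
    rw [hH] at h4
    have hA4 : (A u v : ℂ) ^ 4 ≠ 0 := pow_ne_zero _ (Nat.cast_ne_zero.2 hA)
    have h5 : t u ^ 4 * (starRingEnd ℂ) (t v) ^ 4 = 1 :=
      mul_right_cancel₀ hA4 (by linear_combination h4)
    have h6 : t v ^ 4 * (starRingEnd ℂ) (t v) ^ 4 = 1 := by rw [← mul_pow, htt, one_pow]
    linear_combination t v ^ 4 * h5 - t u ^ 4 * h6
  obtain ⟨r⟩ := hconn.nonempty
  have hall : ∀ v, t v ^ 4 = t r ^ 4 :=
    hconn.forall_of_adj (p := fun v => t v ^ 4 = t r ^ 4) (fun u v huv hu => by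
      rw [SimpleGraph.fromRel_adj] at huv
      rcases huv.2 with hA | hA
      · rw [← hadj u v hA, hu]
      · rw [hadj v u hA, hu]) (r := r) rfl
  refine ⟨fun v => t v * (starRingEnd ℂ) (t r), fun v => ?_, fun u v => ?_⟩
  · rw [Complex.mem_fourth_roots_iff, mul_pow, hall, ← mul_pow, htt, one_pow]
  · rw [hH, map_mul, Complex.conj_conj]
    linear_combination (t u * (starRingEnd ℂ) (t v) * (A u v : ℂ)) * htt r

theorem charpoly_neg_eq_of_switching {H B : Matrix V V ℂ} {s : V → ℂ}
    (hs : ∀ v, s v * (starRingEnd ℂ) (s v) = 1)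
    (hH : ∀ u v, H u v = - s u * (starRingEnd ℂ) (s v) * B u v) :
    (-H).charpoly = B.charpoly := by
  have hD : Matrix.diagonal s * Matrix.diagonal (fun v => (starRingEnd ℂ) (s v)) = 1 := by
    simp [Matrix.diagonal_mul_diagonal, hs]
  have hconj : -H = Matrix.diagonal s * (B * Matrix.diagonal (fun v => (starRingEnd ℂ) (s v))) := by
    ext u v
    rw [Matrix.diagonal_mul, Matrix.mul_diagonal, Matrix.neg_apply, hH]
    ring
  rw [hconj, Matrix.charpoly_mul_comm, Matrix.mul_assoc, mul_eq_one_comm.1 hD, Matrix.mul_one]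

end




theorem stmt4 {V : Type*} [Fintype V] [DecidableEq V]
    (A : Matrix V V ℕ) (hAsymm : ∀ u v, A u v = A v u)
    (hconn : (SimpleGraph.fromRel (fun u v => A u v ≠ 0)).Connected)
    (H : Matrix V V ℂ) (hHerm : H.IsHermitian)
    (hmixed : ∀ u v, ∃ k₀ k₁ : ℕ, k₀ + k₁ ≤ A u v ∧
      (H u v = (k₀ : ℂ) + (k₁ : ℂ) * Complex.I ∨ H u v = (k₀ : ℂ) - (k₁ : ℂ) * Complex.I) ∧
      (u = v → k₁ = 0))
    (hAHerm : (A.map (fun k => (k : ℂ))).IsHermitian) :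
    ((-H).charpoly = (A.map (fun k => (k : ℂ))).charpoly ↔
      ∃ s : V → ℂ, (∀ v, s v ∈ ({1, -1, Complex.I, -Complex.I} : Set ℂ)) ∧
        ∀ u v, H u v = - s u * (starRingEnd ℂ) (s v) * (A u v : ℂ)) ∧
    ((⨅ i, hHerm.eigenvalues i) = -(⨆ i, hAHerm.eigenvalues i) ↔
      ∃ s : V → ℂ, (∀ v, s v ∈ ({1, -1, Complex.I, -Complex.I} : Set ℂ)) ∧
        ∀ u v, H u v = - s u * (starRingEnd ℂ) (s v) * (A u v : ℂ)) := by
  have := hconn.nonempty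
  have hb : (-H).charpoly = (A.map (fun k => (k : ℂ))).charpoly →
      (⨅ i, hHerm.eigenvalues i) = -(⨆ i, hAHerm.eigenvalues i) :=
    hHerm.iInf_eigenvalues_eq_neg_iSup_of_charpoly_neg_eq hAHerm
  have hc : (⨅ i, hHerm.eigenvalues i) = -(⨆ i, hAHerm.eigenvalues i) →
      ∃ s : V → ℂ, (∀ v, s v ∈ ({1, -1, Complex.I, -Complex.I} : Set ℂ)) ∧
        ∀ u v, H u v = - s u * (starRingEnd ℂ) (s v) * (A u v : ℂ) := by
    intro h
    obtain ⟨i, hi⟩ := exists_eq_ciInf_of_finite (f := hHerm.eigenvalues)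
    refine exists_switching_of_eigenvector hAsymm hconn
      (fun u v => ?_) hAHerm.posSemidef_iSup_eigenvalues_smul_one_sub_s4
      (x := hHerm.eigenvectorBasis i) ?_ (fun u => ?_)
    · obtain ⟨k₀, k₁, hk, hz, _⟩ := hmixed u v
      exact ⟨k₀, k₁, hk, hz⟩
    · by_contra! h0
      exact hHerm.eigenvectorBasis.toBasis.ne_zero i (by ext v; simpa using h0 v)
    · have := congrFun (hHerm.mulVec_eigenvectorBasis i) u
      rw [hi, h] at this
      simpa [Matrix.mulVec, dotProduct] using this
  have ha : (∃ s : V → ℂ, (∀ v, s v ∈ ({1, -1, Complex.I, -Complex.I} : Set ℂ)) ∧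
        ∀ u v, H u v = - s u * (starRingEnd ℂ) (s v) * (A u v : ℂ)) →
      (-H).charpoly = (A.map (fun k => (k : ℂ))).charpoly := by
    rintro ⟨s, hs, hH⟩
    refine charpoly_neg_eq_of_switching (s := s) (fun v => ?_) (by simpa using hH)
    rcases hs v with h | h | h | h <;> rw [h] <;> simp
  exact ⟨⟨fun h => hc (hb h), ha⟩, ⟨hc, fun h => hb (ha h)⟩⟩
end

section
/- Let H be the Hermitian adjacency matrix of a mixed graph on a finite vertex type V with Matrix.rank H = 2, and let G(H) be its underlying graph (u ~ v iff u ≠ v and H u v ≠ 0). Then: (a) any two vertices of V that are each incident with at least one edge of G(H) lie in the same connected component of G(H) (so H consists of one nontrivial component plus isolated vertices); (b) for every subset S of V, the principal submatrix of H indexed by S has rank 0 or rank 2; (c) G(H) contains no induced path on 4 vertices — there are no four distinct vertices a, b, c, d with a ~ b, b ~ c, c ~ d and ¬(a ~ c), ¬(a ~ d), ¬(b ~ d) — and for every k ≥ 5, G(H) contains no induced cycle of length k. -/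
open Complex

theorem Matrix.card_le_rank_of_det_submatrix_ne_zero {m n k K : Type*} [Fintype n] [Fintype k]
    [DecidableEq k] [Field K] (A : Matrix m n K) (r : k → m) (c : k → n)
    (h : (A.submatrix r c).det ≠ 0) : Fintype.card k ≤ A.rank := by
  rw [← Matrix.rank_of_isUnit _ ((Matrix.isUnit_iff_isUnit_det _).2 h.isUnit)]
  exact A.rank_submatrix_le r c

/-- In a Hermitian matrix of rank at most two with zero diagonal, an edge dominates
every vertex which is not isolated. -/
theorem Matrix.IsHermitian.ne_zero_or_ne_zero_of_rank_le_two {V : Type*} [Fintype V]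
    {H : Matrix V V ℂ} (hH : H.IsHermitian) (hdiag : ∀ v, H v v = 0) (hrank : H.rank ≤ 2)
    {a b c d : V} (hab : H a b ≠ 0) (hcd : H c d ≠ 0) : H c a ≠ 0 ∨ H c b ≠ 0 := by
  by_contra! h
  have hba : H b a ≠ 0 := by rw [← hH.apply]; exact star_ne_zero.2 hab
  have hdet : (H.submatrix ![a, b, c] ![a, b, d]).det ≠ 0 := by
    rw [Matrix.det_fin_three]
    simp [hdiag, h.1, h.2, hab, hba, hcd]
  have := H.card_le_rank_of_det_submatrix_ne_zero _ _ hdet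
  simp only [Fintype.card_fin] at this
  omega

/-- A nonzero Hermitian matrix with zero diagonal has rank at least two. -/
theorem Matrix.IsHermitian.two_le_rank {V : Type*} [Fintype V]
    {H : Matrix V V ℂ} (hH : H.IsHermitian) (hdiag : ∀ v, H v v = 0) (hne : H ≠ 0) :
    2 ≤ H.rank := by
  obtain ⟨u, v, huv⟩ : ∃ u v, H u v ≠ 0 := by
    by_contra! h
    exact hne (Matrix.ext h)
  have hvu : H v u ≠ 0 := by rw [← hH.apply]; exact star_ne_zero.2 huv
  have hdet : (H.submatrix ![u, v] ![u, v]).det ≠ 0 := by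
    rw [Matrix.det_fin_two]
    simp [hdiag, huv, hvu]
  simpa using H.card_le_rank_of_det_submatrix_ne_zero _ _ hdet

theorem stmt5 {V : Type*} [Fintype V] [DecidableEq V]
    (H : Matrix V V ℂ) (hH : IsHermAdj H) (hrank : Matrix.rank H = 2)
    (G : SimpleGraph V) (hG : ∀ u v, G.Adj u v ↔ u ≠ v ∧ H u v ≠ 0) :
    -- (a) all non-isolated vertices lie in one connected component
    (∀ u v : V, (∃ w, G.Adj u w) → (∃ w, G.Adj v w) → G.Reachable u v) ∧
    -- (b) every principal submatrix has rank 0 or 2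
    (∀ S : Finset V,
      Matrix.rank (H.submatrix (fun x : {x : V // x ∈ S} => (x : V))
        (fun x : {x : V // x ∈ S} => (x : V))) = 0 ∨
      Matrix.rank (H.submatrix (fun x : {x : V // x ∈ S} => (x : V))
        (fun x : {x : V // x ∈ S} => (x : V))) = 2) ∧
    -- (c) no induced path on 4 vertices ...
    (¬ ∃ a b c d : V, a ≠ b ∧ a ≠ c ∧ a ≠ d ∧ b ≠ c ∧ b ≠ d ∧ c ≠ d ∧
      G.Adj a b ∧ G.Adj b c ∧ G.Adj c d ∧ ¬ G.Adj a c ∧ ¬ G.Adj a d ∧ ¬ G.Adj b d) ∧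
    -- ... and no induced cycle of length k ≥ 5
    (∀ k : ℕ, 5 ≤ k → ¬ ∃ f : ZMod k → V, Function.Injective f ∧
      (∀ i, G.Adj (f i) (f (i + 1))) ∧
      (∀ i j : ZMod k, j ≠ i → j ≠ i + 1 → j ≠ i - 1 → ¬ G.Adj (f i) (f j))) := by
  obtain ⟨hherm, hdiag, -⟩ := hH
  have hadj : ∀ u v, G.Adj u v ↔ H u v ≠ 0 := fun u v => by
    rw [hG, and_iff_right_iff_imp]
    rintro h rfl
    exact h (hdiag u)
  have hdom : ∀ {a b c d : V}, G.Adj a b → G.Adj c d → G.Adj c a ∨ G.Adj c b := by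
    intro a b c d hab hcd
    simp only [hadj] at *
    exact hherm.ne_zero_or_ne_zero_of_rank_le_two hdiag hrank.le hab hcd
  refine ⟨?_, ?_, ?_, ?_⟩
  · rintro u v ⟨w, huw⟩ ⟨x, hvx⟩
    rcases hdom huw hvx with h | h
    · exact h.symm.reachable
    · exact huw.reachable.trans h.symm.reachable
  · intro S
    have hle := H.rank_submatrix_le (fun x : {x : V // x ∈ S} => (x : V))
      (fun x : {x : V // x ∈ S} => (x : V))
    rw [hrank] at hle
    by_cases h0 : H.submatrix (fun x : {x : V // x ∈ S} => (x : V))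
        (fun x : {x : V // x ∈ S} => (x : V)) = 0
    · left
      rw [h0, Matrix.rank_zero]
    · right
      exact hle.antisymm ((hherm.submatrix _).two_le_rank (fun v => hdiag v) h0)
  · rintro ⟨a, b, c, d, -, -, -, -, -, -, hab, -, hcd, -, had, hbd⟩
    rcases hdom hab hcd.symm with h | h
    · exact had h.symm
    · exact hbd h.symm
  · rintro k hk ⟨f, -, hadj_succ, hnonadj⟩
    have hne : ∀ n : ℕ, 0 < n → n < 5 → (n : ZMod k) ≠ 0 := fun n hn hn5 h =>
      absurd (Nat.le_of_dvd hn ((ZMod.natCast_eq_zero_iff n k).1 h)) (by omega)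
    have h1 := hne 1 (by norm_num) (by norm_num)
    have h2 := hne 2 (by norm_num) (by norm_num)
    have h3 := hne 3 (by norm_num) (by norm_num)
    have h4 := hne 4 (by norm_num) (by norm_num)
    push_cast at h1 h2 h3 h4
    rcases hdom (hadj_succ 0) (hadj_succ 3) with h | h
    · exact hnonadj 0 3 h3 (fun e => h2 (by linear_combination e))
        (fun e => h4 (by linear_combination e)) h.symm
    · exact hnonadj (0 + 1) 3 (fun e => h2 (by linear_combination e))
        (fun e => h1 (by linear_combination e)) (fun e => h3 (by linear_combination e)) h.symm
end

section
/- For x, y, z ∈ ({0, I, -I} : Set ℂ), let H(x,y,z) : Matrix (Fin 4) (Fin 4) ℂ be the matrix with rows (0, 1, 1, 1), (1, 0, x, -y), (1, -x, 0, z), (1, y, -z, 0). Then Matrix.rank (H(x,y,z)) = 2 if and only if either x = y = z = 0, or one of x, y, z equals 0, another equals I, and the remaining one equals -I (equivalently, if and only if x + y + z = 0). -/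
open Complex

/-- The matrix `H(x,y,z)` with rows `(0,1,1,1)`, `(1,0,x,-y)`, `(1,-x,0,z)`, `(1,y,-z,0)`. -/
def Hxyz (x y z : ℂ) : Matrix (Fin 4) (Fin 4) ℂ :=
  !![0, 1, 1, 1;
     1, 0, x, -y;
     1, -x, 0, z;
     1, y, -z, 0]

theorem det_Hxyz (x y z : ℂ) : (Hxyz x y z).det = -(x + y + z) ^ 2 := by
  simp [Hxyz, Matrix.det_succ_row_zero, Fin.sum_univ_succ, Fin.succAbove]
  ring

theorem two_le_rank_Hxyz (x y z : ℂ) : 2 ≤ (Hxyz x y z).rank := by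
  let P : Matrix (Fin 2) (Fin 4) ℂ := !![0, 1, 0, 0; 1, 0, 0, 0]
  let Q : Matrix (Fin 4) (Fin 2) ℂ := !![1, 0; 0, 1; 0, 0; 0, 0]
  have h : P * (Hxyz x y z * Q) = 1 := by
    ext i j
    fin_cases i <;> fin_cases j <;> simp [P, Q, Hxyz, Matrix.mul_apply, Fin.sum_univ_succ]
  calc
    2 = (1 : Matrix (Fin 2) (Fin 2) ℂ).rank := by simp
    _ ≤ (Hxyz x y z * Q).rank := h ▸ Matrix.rank_mul_le_right _ _
    _ ≤ (Hxyz x y z).rank := Matrix.rank_mul_le_left _ _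

theorem rank_Hxyz_le_two {x y z : ℂ} (h : x + y + z = 0) : (Hxyz x y z).rank ≤ 2 := by
  have hz : z = -x - y := by linear_combination h
  have hmul : Hxyz x y z =
      !![1, 0; 0, 1; -x, 1; y, 1] * !![0, 1, 1, 1; 1, 0, x, -y] := by
    subst hz
    ext i j
    fin_cases i <;> fin_cases j <;> simp [Hxyz, Matrix.mul_apply, Fin.sum_univ_succ]
    ring
  rw [hmul]
  exact (Matrix.rank_mul_le_left _ _).trans (Matrix.rank_le_width _)

theorem rank_Hxyz_eq_two_iff (x y z : ℂ) : (Hxyz x y z).rank = 2 ↔ x + y + z = 0 := by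
  refine ⟨fun h => ?_, fun h => (rank_Hxyz_le_two h).antisymm (two_le_rank_Hxyz x y z)⟩
  by_contra hs
  have hu : IsUnit (Hxyz x y z) := by
    rw [Matrix.isUnit_iff_isUnit_det, det_Hxyz, isUnit_iff_ne_zero]
    exact neg_ne_zero.mpr (pow_ne_zero 2 hs)
  simp [Matrix.rank_of_isUnit _ hu] at h

theorem stmt7 (x y z : ℂ)
    (hx : x ∈ ({0, Complex.I, -Complex.I} : Set ℂ))
    (hy : y ∈ ({0, Complex.I, -Complex.I} : Set ℂ))
    (hz : z ∈ ({0, Complex.I, -Complex.I} : Set ℂ)) :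
    (Matrix.rank (Hxyz x y z) = 2 ↔
      ((x = 0 ∧ y = 0 ∧ z = 0) ∨
       (x = 0 ∧ ((y = Complex.I ∧ z = -Complex.I) ∨ (y = -Complex.I ∧ z = Complex.I))) ∨
       (y = 0 ∧ ((x = Complex.I ∧ z = -Complex.I) ∨ (x = -Complex.I ∧ z = Complex.I))) ∨
       (z = 0 ∧ ((x = Complex.I ∧ y = -Complex.I) ∨ (x = -Complex.I ∧ y = Complex.I))))) ∧
    (Matrix.rank (Hxyz x y z) = 2 ↔ x + y + z = 0) := by
  refine ⟨(rank_Hxyz_eq_two_iff x y z).trans ?_, rank_Hxyz_eq_two_iff x y z⟩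
  simp only [Set.mem_insert_iff, Set.mem_singleton_iff] at hx hy hz
  rcases hx with rfl | rfl | rfl <;> rcases hy with rfl | rfl | rfl <;>
    rcases hz with rfl | rfl | rfl <;> norm_num [Complex.ext_iff]
end

section
/- Let H be the Hermitian adjacency matrix of a mixed graph on Fin 4 whose underlying graph is the 4-cycle v₀v₁v₂v₃: H v₀ v₂ = 0, H v₁ v₃ = 0, and each of H v₀ v₁, H v₁ v₂, H v₂ v₃, H v₃ v₀ lies in {1, I, -I}. Let A be the adjacency matrix of this 4-cycle (A u v = 1 for cyclically consecutive u ≠ v, 0 otherwise). Then Matrix.rank H = 2 if and only if there exists s : Fin 4 → ℂ with s v ∈ {1, -1, I, -I} for all v such that H u v = s u * conj (s v) * A u v for all u, v, i.e. if and only if H is switching equivalent to the undirected 4-cycle. -/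
open Complex

/-- The adjacency matrix of the 4-cycle `v₀v₁v₂v₃` on `Fin 4`. -/
def C4adj : Matrix (Fin 4) (Fin 4) ℂ :=
  fun u v => if u = v + 1 ∨ v = u + 1 then 1 else 0

/-- The determinant of a matrix supported on the edges of the 4-cycle is the product of the
determinants of its two off-diagonal blocks. -/
lemma det_fin_four_cycle {H : Matrix (Fin 4) (Fin 4) ℂ} (hd : ∀ v, H v v = 0)
    (h02 : H 0 2 = 0) (h20 : H 2 0 = 0) (h13 : H 1 3 = 0) (h31 : H 3 1 = 0) :
    H.det = (H 0 1 * H 2 3 - H 0 3 * H 2 1) * (H 1 0 * H 3 2 - H 3 0 * H 1 2) := by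
  have hH : H = !![0, H 0 1, 0, H 0 3; H 1 0, 0, H 1 2, 0; 0, H 2 1, 0, H 2 3;
      H 3 0, 0, H 3 2, 0] := by
    ext u v
    fin_cases u <;> fin_cases v <;> simp [hd, h02, h20, h13, h31]
  rw [congrArg Matrix.det hH]
  simp [Matrix.det_succ_row_zero, Fin.sum_univ_succ, Fin.succAbove]
  ring

/-- A matrix that is diagonally similar to the 4-cycle has rank at most two. -/
lemma rank_mul_C4adj_le (s t : Fin 4 → ℂ) :
    (Matrix.of fun u v => s u * t v * C4adj u v).rank ≤ 2 := by
  let P : Matrix (Fin 4) (Fin 2) ℂ := !![s 0, 0; 0, s 1; s 2, 0; 0, s 3]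
  let Q : Matrix (Fin 2) (Fin 4) ℂ := !![0, t 1, 0, t 3; t 0, 0, t 2, 0]
  have h : (Matrix.of fun u v => s u * t v * C4adj u v) = P * Q := by
    ext u v
    fin_cases u <;> fin_cases v <;>
      simp [P, Q, C4adj, Matrix.mul_apply, Fin.sum_univ_two]
  rw [h]
  exact (Matrix.rank_mul_le_left P Q).trans (Matrix.rank_le_width P)

/-- A matrix with an antidiagonal leading `2 × 2` block has rank at least two. -/
lemma two_le_rank_of_antidiagonal {H : Matrix (Fin 4) (Fin 4) ℂ} (h00 : H 0 0 = 0)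
    (h01 : H 0 1 ≠ 0) (h10 : H 1 0 ≠ 0) : 2 ≤ H.rank := by
  have hu : IsUnit (H.submatrix ![0, 1] ![0, 1]) := by
    rw [Matrix.isUnit_iff_isUnit_det, Matrix.det_fin_two, isUnit_iff_ne_zero]
    simp [h00, h01, h10]
  have h := Matrix.rank_submatrix_le H ![0, 1] ![0, 1]
  rwa [Matrix.rank_of_isUnit _ hu, Fintype.card_fin] at h

lemma mul_conj_of_mem {z : ℂ} (hz : z ∈ ({1, Complex.I, -Complex.I} : Set ℂ)) :
    z * (starRingEnd ℂ) z = 1 := by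
  rcases hz with rfl | rfl | rfl <;> simp

lemma mul_mem_units {z w : ℂ} (hz : z ∈ ({1, -1, Complex.I, -Complex.I} : Set ℂ))
    (hw : w ∈ ({1, Complex.I, -Complex.I} : Set ℂ)) :
    z * (starRingEnd ℂ) w ∈ ({1, -1, Complex.I, -Complex.I} : Set ℂ) := by
  rcases hz with rfl | rfl | rfl | rfl <;> rcases hw with rfl | rfl | rfl <;> simp

theorem stmt8 (H : Matrix (Fin 4) (Fin 4) ℂ) (hH : IsHermAdj H)
    (h02 : H 0 2 = 0) (h13 : H 1 3 = 0)
    (h01 : H 0 1 ∈ ({1, Complex.I, -Complex.I} : Set ℂ))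
    (h12 : H 1 2 ∈ ({1, Complex.I, -Complex.I} : Set ℂ))
    (h23 : H 2 3 ∈ ({1, Complex.I, -Complex.I} : Set ℂ))
    (h30 : H 3 0 ∈ ({1, Complex.I, -Complex.I} : Set ℂ)) :
    Matrix.rank H = 2 ↔
      ∃ s : Fin 4 → ℂ, (∀ v, s v ∈ ({1, -1, Complex.I, -Complex.I} : Set ℂ)) ∧
        ∀ u v, H u v = s u * (starRingEnd ℂ) (s v) * C4adj u v := by
  obtain ⟨hherm, hdiag, -⟩ := hH
  have hc : ∀ u v, H u v = (starRingEnd ℂ) (H v u) := fun u v => (hherm.apply u v).symm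
  have n01 := mul_conj_of_mem h01
  have n12 := mul_conj_of_mem h12
  have n23 := mul_conj_of_mem h23
  have n30 := mul_conj_of_mem h30
  constructor
  · intro hr
    have hdet : H.det = 0 := by
      by_contra hne
      have h := Matrix.rank_of_isUnit H
        ((Matrix.isUnit_iff_isUnit_det H).2 (isUnit_iff_ne_zero.2 hne))
      simp [hr] at h
    have h20 : H 2 0 = 0 := by rw [hc, h02, map_zero]
    have h31 : H 3 1 = 0 := by rw [hc, h13, map_zero]
    rw [det_fin_four_cycle hdiag h02 h20 h13 h31, hc 1 0, hc 3 2, hc 0 3, hc 2 1] at hdet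
    have key : (starRingEnd ℂ) (H 0 1) * (starRingEnd ℂ) (H 2 3) = H 3 0 * H 1 2 := by
      rcases mul_eq_zero.1 hdet with h | h
      · have h' := congrArg (starRingEnd ℂ) h
        simp only [map_sub, map_mul, Complex.conj_conj, map_zero] at h'
        exact sub_eq_zero.1 h'
      · exact sub_eq_zero.1 h
    have e30 : H 3 0 = (starRingEnd ℂ) (H 0 1) * (starRingEnd ℂ) (H 1 2) *
        (starRingEnd ℂ) (H 2 3) := by
      linear_combination (-(starRingEnd ℂ) (H 1 2)) * key - H 3 0 * n12
    have m1 := mul_mem_units (z := 1) (by simp) h01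
    have m2 := mul_mem_units m1 h12
    have m3 := mul_mem_units m2 h23
    rw [one_mul] at m1 m2 m3
    have e03 : H 0 3 = H 0 1 * H 1 2 * H 2 3 := by rw [hc, e30]; simp
    refine ⟨![1, (starRingEnd ℂ) (H 0 1), (starRingEnd ℂ) (H 0 1) * (starRingEnd ℂ) (H 1 2),
      (starRingEnd ℂ) (H 0 1) * (starRingEnd ℂ) (H 1 2) * (starRingEnd ℂ) (H 2 3)], ?_, ?_⟩
    · intro v
      fin_cases v
      exacts [by simp, m1, m2, m3]
    · intro u v
      fin_cases u <;> fin_cases v <;>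
        simp [C4adj, hdiag, h02, h13, h20, h31, e30, e03, hc 1 0, hc 2 1, hc 3 2]
      · linear_combination (-H 1 2) * n01
      · linear_combination (-(starRingEnd ℂ) (H 1 2)) * n01
      · linear_combination (-H 2 3) * n01 - H 2 3 * H 0 1 * (starRingEnd ℂ) (H 0 1) * n12
      · linear_combination (-(starRingEnd ℂ) (H 2 3)) * n01 -
          (starRingEnd ℂ) (H 2 3) * H 0 1 * (starRingEnd ℂ) (H 0 1) * n12
  · rintro ⟨s, -, hs⟩
    have ne01 : H 0 1 ≠ 0 := left_ne_zero_of_mul_eq_one n01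
    have ne10 : H 1 0 ≠ 0 := by rw [hc]; exact right_ne_zero_of_mul_eq_one n01
    have hle := rank_mul_C4adj_le s fun v => (starRingEnd ℂ) (s v)
    rw [← show H = _ from Matrix.ext hs] at hle
    exact le_antisymm hle (two_le_rank_of_antidiagonal (hdiag 0) ne01 ne10)
end

section
/- Let H be the Hermitian adjacency matrix of a mixed graph on a finite vertex type V whose underlying graph G(H) is connected, and suppose Matrix.rank H = 2. Then G(H) is a complete bipartite or a complete tripartite graph: there exists a partition of V into r nonempty parts with r = 2 or r = 3 such that distinct vertices u, v are adjacent in G(H) if and only if they lie in different parts. -/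
open Complex

/-- In a rank two matrix, if `H a a = 0` and `H a b`, `H b a` are nonzero, then the rows `a` and `b`
span all the rows. -/
theorem Matrix.exists_row_eq_of_rank_eq_two {K V : Type*} [Field K] [Fintype V] (H : Matrix V V K)
    (hrank : H.rank = 2) {a b : V} (ha : H a a = 0)
    (hab : H a b ≠ 0) (hba : H b a ≠ 0) (u : V) :
    ∃ s t : K, ∀ v, H u v = s * H a v + t * H b v := by
  have hli : LinearIndependent K ![H a, H b] := by
    rw [LinearIndependent.pair_iff]
    intro s t hst
    have h1 := congrFun hst a
    have h2 := congrFun hst b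
    simp_all
  have hle : Submodule.span K (Set.range ![H a, H b]) ≤ Submodule.span K (Set.range H.row) := by
    apply Submodule.span_mono
    rintro _ ⟨i, rfl⟩
    fin_cases i
    exacts [⟨a, rfl⟩, ⟨b, rfl⟩]
  have heq := Submodule.eq_of_le_of_finrank_eq hle (by
    rw [finrank_span_eq_card hli, ← H.rank_eq_finrank_span_row, hrank, Fintype.card_fin])
  have hu : H u ∈ Submodule.span K (Set.range ![H a, H b]) :=
    heq ▸ Submodule.subset_span ⟨u, rfl⟩
  rw [Matrix.range_cons_cons_empty, Submodule.mem_span_pair] at hu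
  obtain ⟨s, t, hst⟩ := hu
  exact ⟨s, t, fun v => by simp [← hst]⟩

theorem IsHermAdj.mul_swap {V : Type*} [Fintype V] {H : Matrix V V ℂ} (hH : IsHermAdj H)
    {u v : V} (h : H u v ≠ 0) : H u v * H v u = 1 := by
  have h1 := hH.1.apply v u
  have h2 := hH.2.2 u v
  simp only [Set.mem_insert_iff, Set.mem_singleton_iff] at h2
  rw [← h1]
  rcases h2 with h2 | h2 | h2 | h2
  · exact absurd h2 h
  all_goals simp [h2]

theorem IsHermAdj.swap_ne_zero {V : Type*} [Fintype V] {H : Matrix V V ℂ} (hH : IsHermAdj H)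
    {u v : V} (h : H u v ≠ 0) : H v u ≠ 0 :=
  right_ne_zero_of_mul_eq_one (hH.mul_swap h)

theorem IsHermAdj.swap_eq_zero {V : Type*} [Fintype V] {H : Matrix V V ℂ} (hH : IsHermAdj H)
    {u v : V} (h : H u v = 0) : H v u = 0 := by
  by_contra h'
  exact hH.swap_ne_zero h' h

theorem IsHermAdj.apply_eq_of_rank_eq_two {V : Type*} [Fintype V] {H : Matrix V V ℂ}
    (hH : IsHermAdj H) (hrank : H.rank = 2) {a b : V} (hab : H a b ≠ 0) (u v : V) :
    H u v = H u b * H b a * H a v + H u a * H a b * H b v := by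
  obtain ⟨s, t, h⟩ := H.exists_row_eq_of_rank_eq_two hrank (hH.2.1 a) hab
    (hH.swap_ne_zero hab) u
  have h1 := h a
  have h2 := h b
  rw [hH.2.1] at h1 h2
  have h3 := hH.mul_swap hab
  rw [h v, h1, h2]
  linear_combination (-(s * H a v) - t * H b v) * h3

/-- In rank two, the common neighbours of the ends of an edge are pairwise non-adjacent. -/
theorem IsHermAdj.apply_eq_zero_of_common_neighbors {V : Type*} [Fintype V] {H : Matrix V V ℂ}
    (hH : IsHermAdj H) (hrank : H.rank = 2) {a b : V} (hab : H a b ≠ 0) {u v : V}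
    (hua : H u a ≠ 0) (hub : H u b ≠ 0) (hva : H v a ≠ 0) (hvb : H v b ≠ 0) : H u v = 0 := by
  by_contra huv
  have key := hH.apply_eq_of_rank_eq_two hrank hab
  have e := hH.mul_swap huv
  have eh := hH.mul_swap hab
  have eua := hH.mul_swap hua
  have eub := hH.mul_swap hub
  have eva := hH.mul_swap hva
  have evb := hH.mul_swap hvb
  have du := (key u u).symm.trans (hH.2.1 u)
  have dv := (key v v).symm.trans (hH.2.1 v)
  obtain ⟨z, hz⟩ : ∃ z, z = H u a * H a b * H b u := ⟨_, rfl⟩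
  obtain ⟨w, hw⟩ : ∃ w, w = H v a * H a b * H b v := ⟨_, rfl⟩
  have hz' : H u b * H b a * H a u = -z := by linear_combination du + hz
  have hw' : H v b * H b a * H a v = -w := by linear_combination dv + hw
  have hz2 : z * -z = 1 := by
    rw [← hz', hz]
    linear_combination (H a b * H b a * H u b * H b u) * eua + H a b * H b a * eub + eh
  have hw2 : w * -w = 1 := by
    rw [← hw', hw]
    linear_combination (H a b * H b a * H v b * H b v) * eva + H a b * H b a * evb + eh
  have k1 : H u v = H u b * H b v * (z - w) := by
    rw [key u v, sub_eq_add_neg, ← hw', hz]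
    linear_combination (-(H u a * H a b * H b v)) * eub - (H u b * H b a * H a v) * evb
  have k2 : H v u = H v b * H b u * (w - z) := by
    rw [key v u, sub_eq_add_neg, ← hz', hw]
    linear_combination (-(H v a * H a b * H b u)) * evb - (H v b * H b a * H a u) * eub
  have k3 : (z - w) * (w - z) = 1 := by
    rw [k1, k2] at e
    linear_combination e - (z - w) * (w - z) * (H v b * H b v * eub + evb)
  have k4 : z * w = -1 / 2 := by linear_combination (k3 - hz2 - hw2) / 2
  have k5 : (z * w) ^ 2 = 1 := by linear_combination (-(w * w)) * hz2 + hw2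
  rw [k4] at k5
  norm_num at k5

theorem stmt9 {V : Type*} [Fintype V] [DecidableEq V]
    (H : Matrix V V ℂ) (hH : IsHermAdj H)
    (G : SimpleGraph V) (hG : ∀ u v, G.Adj u v ↔ u ≠ v ∧ H u v ≠ 0)
    (hconn : G.Connected) (hrank : Matrix.rank H = 2) :
    ∃ r : ℕ, (r = 2 ∨ r = 3) ∧ ∃ P : V → Fin r,
      (∀ j : Fin r, ∃ v, P v = j) ∧
      ∀ u v : V, u ≠ v → (G.Adj u v ↔ P u ≠ P v) := by
  obtain ⟨a, b, hab⟩ : ∃ a b, H a b ≠ 0 := by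
    by_contra! h
    rw [show H = 0 from Matrix.ext h, Matrix.rank_zero] at hrank
    omega
  have key := hH.apply_eq_of_rank_eq_two hrank hab
  have hba := hH.swap_ne_zero hab
  have haa := hH.2.1 a
  have hbb := hH.2.1 b
  have hcover : ∀ u, H u a = 0 → H u b ≠ 0 := by
    intro u h1 h2
    have : Nontrivial V := ⟨a, b, by rintro rfl; exact hab haa⟩
    obtain ⟨v, hv⟩ := hconn.preconnected.exists_adj_of_nontrivial u
    exact ((hG u v).1 hv).2 (by rw [key, h1, h2]; ring)
  have hA : ∀ u v, H u a = 0 → (H u v = 0 ↔ H v a = 0) := by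
    intro u v hu
    have := hcover u hu
    have hs : H a v = 0 ↔ H v a = 0 := ⟨hH.swap_eq_zero, hH.swap_eq_zero⟩
    rw [key u v, hu, ← hs]
    simp [this, hba]
  have hB : ∀ u v, H u b = 0 → (H u v = 0 ↔ H v b = 0) := by
    intro u v hu
    have : H u a ≠ 0 := fun h => hcover u h hu
    have hs : H b v = 0 ↔ H v b = 0 := ⟨hH.swap_eq_zero, hH.swap_eq_zero⟩
    rw [key u v, hu, ← hs]
    simp [this, hab]
  have hC : ∀ u v, H u a ≠ 0 → H u b ≠ 0 →
      (H u v = 0 ↔ H v a ≠ 0 ∧ H v b ≠ 0) := by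
    intro u v h1 h2
    have hs : H u v = 0 ↔ H v u = 0 := ⟨hH.swap_eq_zero, hH.swap_eq_zero⟩
    constructor
    · intro h
      exact ⟨fun h' => h1 ((hA v u h').1 (hs.1 h)), fun h' => h2 ((hB v u h').1 (hs.1 h))⟩
    · rintro ⟨h3, h4⟩
      exact hH.apply_eq_zero_of_common_neighbors hrank hab h1 h2 h3 h4
  classical
  by_cases hc : ∃ c, H c a ≠ 0 ∧ H c b ≠ 0
  · obtain ⟨c, hca, hcb⟩ := hc
    refine ⟨3, .inr rfl, fun u => if H u a = 0 then 0 else if H u b = 0 then 1 else 2, ?_, ?_⟩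
    · intro j
      fin_cases j
      exacts [⟨a, by simp [haa]⟩, ⟨b, by simp [hba, hbb]⟩, ⟨c, by simp [hca, hcb]⟩]
    · intro u v huv
      have := hA u v
      have := hB u v
      have := hC u v
      have := hcover v
      rw [hG]
      clear key hA hB hC hcover
      grind
  · push Not at hc
    refine ⟨2, .inl rfl, fun u => if H u a = 0 then 0 else 1, ?_, ?_⟩
    · intro j
      fin_cases j
      exacts [⟨a, by simp [haa]⟩, ⟨b, by simp [hba]⟩]
    · intro u v huv
      have := hA u v
      have := hB u v
      have := hc u
      have := hc v
      have := hcover v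
      rw [hG]
      clear key hA hB hC hcover
      grind
end

section
/- Let H be the Hermitian adjacency matrix of a mixed graph on a finite vertex type V with Matrix.rank H = 2, and let ρ be its largest eigenvalue. Then there exist s : V → ℂ with s v ∈ {1, -1, I, -I} for all v and pairwise disjoint subsets A, B, C, T of V with union V and with A, B nonempty, such that one of the following holds: (i) C = ∅, H u v = s u * conj (s v) * M u v for all u, v, where M u v = 1 if u and v lie in different ones of A, B and M u v = 0 otherwise (so H is switching equivalent to K_{|A|,|B|} ∪ |T|·K₁), and ρ² = |A|·|B|; or (ii) C ≠ ∅, H u v = s u * conj (s v) * M u v for all u, v, where M u v = I if (u,v) ∈ A×B ∪ B×C ∪ C×A, M u v = -I if (u,v) ∈ B×A ∪ C×B ∪ A×C, and M u v = 0 otherwise (so H is switching equivalent to the cyclically oriented complete tripartite digraph C₃(|A|,|B|,|C|) ∪ |T|·K₁), and ρ² = |A|·|B| + |B|·|C| + |A|·|C|. -/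
open Complex

open Matrix in
/-- The nonzero eigenvalues of a traceless Hermitian matrix `H` of rank two are `ρ` and `-ρ`, where
`ρ` is the largest eigenvalue, so `tr H² = 2 ρ²`. -/
lemma trace_mul_self_of_rank_eq_two {V : Type*} [Fintype V] [DecidableEq V]
    {H : Matrix V V ℂ} (hH : H.IsHermitian) (htr : H.trace = 0) (hrank : H.rank = 2) :
    (H * H).trace = 2 * ((⨆ i, hH.eigenvalues i : ℝ) : ℂ) ^ 2 := by
  have hsum : ∑ i, hH.eigenvalues i = 0 := by
    have h : ((∑ i, hH.eigenvalues i : ℝ) : ℂ) = 0 := by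
      rw [ofReal_sum, ← htr]
      exact hH.trace_eq_sum_eigenvalues.symm
    exact ofReal_eq_zero.mp h
  have hsq : (H * H).trace = ∑ i, ((hH.eigenvalues i : ℝ) : ℂ) ^ 2 := by
    conv_lhs => rw [hH.spectral_theorem]
    rw [← map_mul, Unitary.conjStarAlgAut_apply, Matrix.trace_mul_cycle,
      Unitary.coe_star_mul_self, one_mul, diagonal_mul_diagonal, trace_diagonal]
    simp [pow_two]
  have hcard : (Finset.univ.filter fun i => hH.eigenvalues i ≠ 0).card = 2 := by
    rw [← hrank, hH.rank_eq_card_non_zero_eigs, Fintype.card_subtype]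
  obtain ⟨i, j, hij, hset⟩ := Finset.card_eq_two.mp hcard
  have hzero : ∀ k, k ≠ i → k ≠ j → hH.eigenvalues k = 0 := by
    intro k hki hkj
    by_contra hk
    have : k ∈ ({i, j} : Finset V) := hset ▸ by simpa using hk
    simp [hki, hkj] at this
  have hi : hH.eigenvalues i ≠ 0 := by
    have : i ∈ Finset.univ.filter fun i => hH.eigenvalues i ≠ 0 := by simp [hset]
    simpa using this
  have hadd : hH.eigenvalues i + hH.eigenvalues j = 0 := by
    rw [← hsum, Finset.sum_eq_add i j hij (fun k _ hk => hzero k hk.1 hk.2)] <;> simp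
  have hsup : (⨆ k, hH.eigenvalues k) = |hH.eigenvalues i| := by
    have : Nonempty V := ⟨i⟩
    apply le_antisymm
    · refine ciSup_le fun k => ?_
      by_cases hki : k = i
      · exact hki ▸ le_abs_self _
      by_cases hkj : k = j
      · rw [hkj, eq_neg_of_add_eq_zero_right hadd]
        exact neg_le_abs _
      · rw [hzero k hki hkj]
        exact abs_nonneg _
    · have hb : BddAbove (Set.range hH.eigenvalues) := (Set.finite_range _).bddAbove
      refine abs_le'.mpr ⟨le_ciSup hb i, ?_⟩
      rw [← eq_neg_of_add_eq_zero_right hadd]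
      exact le_ciSup hb j
  rw [hsq, Finset.sum_eq_add i j hij (fun k _ hk => by simp [hzero k hk.1 hk.2]) (by simp)
    (by simp), hsup, eq_neg_of_add_eq_zero_right hadd]
  norm_cast
  rw [sq_abs]
  ring

/-- Over a field every `3 × 3` minor of a matrix of rank at most two vanishes. -/
lemma det_submatrix_eq_zero_of_rank_le_two {V K : Type*} [Fintype V] [Field K]
    {H : Matrix V V K} (hrank : H.rank ≤ 2) (r c : Fin 3 → V) : (H.submatrix r c).det = 0 := by
  by_contra h
  have h1 := Matrix.rank_of_isUnit _ ((Matrix.isUnit_iff_isUnit_det _).mpr (Ne.isUnit h))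
  have h2 := H.rank_submatrix_le r c
  rw [Fintype.card_fin] at h1
  omega

/-- A Hermitian matrix of rank at most two with zero diagonal and a unimodular entry at `(a, b)`
is determined by its columns at `a` and `b`. -/
lemma apply_eq_of_rank_le_two {V : Type*} [Fintype V] {H : Matrix V V ℂ}
    (hH : H.IsHermitian) (hdiag : ∀ v, H v v = 0) (hrank : H.rank ≤ 2) {a b : V}
    (hab : H a b * starRingEnd ℂ (H a b) = 1) (u v : V) :
    H u v = H u a * starRingEnd ℂ (starRingEnd ℂ (H a b) * H v b) +
      (starRingEnd ℂ (H a b) * H u b) * starRingEnd ℂ (H v a) := by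
  have h := det_submatrix_eq_zero_of_rank_le_two hrank ![a, b, u] ![a, b, v]
  have e : ∀ p q, starRingEnd ℂ (H p q) = H q p := fun p q => hH.apply q p
  simp only [Matrix.det_fin_three, Matrix.submatrix_apply, Matrix.cons_val, hdiag] at h
  simp only [map_mul, e] at *
  linear_combination (-H u v) * hab - h

/-- The normal form of a Hermitian matrix `x yᴴ + y xᴴ` with zero diagonal, where `x` and `y`
have entries in `{0, ±1, ±I}`, provided `y` is nowhere a nonzero multiple `-I * x` of `x`. -/
lemma exists_switching {V : Type*} [Fintype V] [DecidableEq V] {H : Matrix V V ℂ} {x y : V → ℂ}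
    (hx : ∀ u, x u ∈ ({0, 1, -1, I, -I} : Set ℂ)) (hy : ∀ u, y u ∈ ({0, 1, -1, I, -I} : Set ℂ))
    (hH : ∀ u v, H u v = x u * starRingEnd ℂ (y v) + y u * starRingEnd ℂ (x v))
    (hxy : ∀ u, x u ≠ 0 → y u ≠ 0 → y u = I * x u)
    (hA : ∃ u, x u = 0 ∧ y u ≠ 0) (hB : ∃ u, x u ≠ 0 ∧ y u = 0) :
    ∃ s : V → ℂ, (∀ v, s v ∈ ({1, -1, I, -I} : Set ℂ)) ∧
    ∃ A B C T : Finset V,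
      (Disjoint A B ∧ Disjoint A C ∧ Disjoint A T ∧ Disjoint B C ∧
        Disjoint B T ∧ Disjoint C T) ∧
      A ∪ B ∪ C ∪ T = Finset.univ ∧ A.Nonempty ∧ B.Nonempty ∧
      ((C = ∅ ∧
        ∀ u v, H u v = s u * (starRingEnd ℂ) (s v) *
          (if (u ∈ A ∧ v ∈ B) ∨ (u ∈ B ∧ v ∈ A) then 1 else 0)) ∨
       (C.Nonempty ∧
        ∀ u v, H u v = s u * (starRingEnd ℂ) (s v) *
          (if (u ∈ A ∧ v ∈ B) ∨ (u ∈ B ∧ v ∈ C) ∨ (u ∈ C ∧ v ∈ A) then I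
           else if (u ∈ B ∧ v ∈ A) ∨ (u ∈ C ∧ v ∈ B) ∨ (u ∈ A ∧ v ∈ C) then -I
           else 0))) := by
  set A := Finset.univ.filter fun u => x u = 0 ∧ y u ≠ 0 with hAdef
  set B := Finset.univ.filter fun u => x u ≠ 0 ∧ y u = 0 with hBdef
  set C := Finset.univ.filter fun u => x u ≠ 0 ∧ y u ≠ 0 with hCdef
  set T := Finset.univ.filter fun u => x u = 0 ∧ y u = 0 with hTdef
  have hdisj : Disjoint A B ∧ Disjoint A C ∧ Disjoint A T ∧ Disjoint B C ∧
      Disjoint B T ∧ Disjoint C T := by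
    simp only [Finset.disjoint_left, hAdef, hBdef, hCdef, hTdef, Finset.mem_filter,
      Finset.mem_univ, true_and]
    tauto
  have hunion : A ∪ B ∪ C ∪ T = Finset.univ := by
    ext u
    simp only [hAdef, hBdef, hCdef, hTdef, Finset.mem_union, Finset.mem_filter,
      Finset.mem_univ, true_and, iff_true]
    tauto
  have hAn : A.Nonempty := hA.imp fun u hu => by simpa [hAdef] using hu
  have hBn : B.Nonempty := hB.imp fun u hu => by simpa [hBdef] using hu
  rcases C.eq_empty_or_nonempty with hC | hC
  · have hC0 : ∀ u, x u ≠ 0 → y u = 0 := by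
      intro u hxu
      by_contra hyu
      have : u ∈ C := by simp [hCdef, hxu, hyu]
      simp [hC] at this
    refine ⟨fun u => if x u = 0 then (if y u = 0 then 1 else y u) else x u, fun u => ?_,
      A, B, C, T, hdisj, hunion, hAn, hBn, Or.inl ⟨hC, fun u v => ?_⟩⟩
    · have h1 := hx u
      have h2 := hy u
      simp only [Set.mem_insert_iff, Set.mem_singleton_iff] at h1 h2 ⊢
      split_ifs <;> tauto
    · rw [hH]
      by_cases hu : x u = 0 <;> by_cases hv : x v = 0 <;>
      by_cases hu' : y u = 0 <;> by_cases hv' : y v = 0 <;>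
      simp_all
  · refine ⟨fun u => if x u = 0 then (if y u = 0 then 1 else y u) else
      if y u = 0 then I * x u else -I * x u, fun u => ?_,
      A, B, C, T, hdisj, hunion, hAn, hBn, Or.inr ⟨hC, fun u v => ?_⟩⟩
    · have h1 := hx u
      have h2 := hy u
      simp only [Set.mem_insert_iff, Set.mem_singleton_iff] at h1 h2 ⊢
      split_ifs with hxu hyu hyu
      · tauto
      · tauto
      · rcases h1 with h1 | h1 | h1 | h1 | h1 <;> simp [h1] at hxu ⊢
      · rcases h1 with h1 | h1 | h1 | h1 | h1 <;> simp [h1] at hxu ⊢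
    · have h1 := hxy u
      have h2 := hxy v
      have hI := I_mul_I
      rw [hH]
      clear hxy hH hA hB hdisj hunion hAn hBn hC hx hy
      simp only [hAdef, hBdef, hCdef, Finset.mem_filter, Finset.mem_univ, true_and]
      by_cases hu : x u = 0 <;> by_cases hv : x v = 0 <;>
      by_cases hu' : y u = 0 <;> by_cases hv' : y v = 0 <;>
      simp [hu, hv, hu', hv'] at h1 h2 ⊢ <;>
      (try simp only [h1, h2, map_mul, conj_I]) <;> grind

/-- Counting adjacent pairs between three pairwise disjoint sets. -/
lemma sum_sum_tripartite {V : Type*} [Fintype V] [DecidableEq V] {A B C : Finset V}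
    (hAB : Disjoint A B) (hAC : Disjoint A C) (hBC : Disjoint B C) :
    (∑ u, ∑ v, if ((u ∈ A ∧ v ∈ B) ∨ (u ∈ B ∧ v ∈ C) ∨ (u ∈ C ∧ v ∈ A)) ∨
      (u ∈ B ∧ v ∈ A) ∨ (u ∈ C ∧ v ∈ B) ∨ (u ∈ A ∧ v ∈ C) then (1 : ℂ) else 0) =
      2 * (A.card * B.card + B.card * C.card + A.card * C.card) := by
  let f : Finset V → V → ℂ := fun S u => if u ∈ S then 1 else 0
  have hf : ∀ S, ∑ u, f S u = S.card := fun S => by simp [f]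
  rw [Finset.disjoint_left] at hAB hAC hBC
  have hterm : ∀ u v, (if ((u ∈ A ∧ v ∈ B) ∨ (u ∈ B ∧ v ∈ C) ∨ (u ∈ C ∧ v ∈ A)) ∨
      (u ∈ B ∧ v ∈ A) ∨ (u ∈ C ∧ v ∈ B) ∨ (u ∈ A ∧ v ∈ C) then (1 : ℂ) else 0) =
      f A u * f B v + f B u * f C v + f C u * f A v +
      f B u * f A v + f C u * f B v + f A u * f C v := by
    intro u v
    have hu1 := @hAB u
    have hu2 := @hAC u
    have hu3 := @hBC u
    have hv1 := @hAB v
    have hv2 := @hAC v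
    have hv3 := @hBC v
    by_cases a : u ∈ A <;> by_cases b : u ∈ B <;> by_cases c : u ∈ C <;>
    by_cases a' : v ∈ A <;> by_cases b' : v ∈ B <;> by_cases c' : v ∈ C <;>
    simp_all [f]
  simp only [hterm, Finset.sum_add_distrib, ← Finset.sum_mul_sum, hf]
  ring

theorem stmt10 {V : Type*} [Fintype V] [DecidableEq V]
    (H : Matrix V V ℂ) (hHerm : H.IsHermitian) (hH : IsHermAdj H)
    (hrank : Matrix.rank H = 2)
    (ρ : ℝ) (hρ : ρ = ⨆ i, hHerm.eigenvalues i) :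
    ∃ s : V → ℂ, (∀ v, s v ∈ ({1, -1, Complex.I, -Complex.I} : Set ℂ)) ∧
    ∃ A B C T : Finset V,
      (Disjoint A B ∧ Disjoint A C ∧ Disjoint A T ∧ Disjoint B C ∧
        Disjoint B T ∧ Disjoint C T) ∧
      A ∪ B ∪ C ∪ T = Finset.univ ∧ A.Nonempty ∧ B.Nonempty ∧
      ((C = ∅ ∧
        (∀ u v, H u v = s u * (starRingEnd ℂ) (s v) *
          (if (u ∈ A ∧ v ∈ B) ∨ (u ∈ B ∧ v ∈ A) then 1 else 0)) ∧
        ρ ^ 2 = (A.card * B.card : ℝ)) ∨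
       (C.Nonempty ∧
        (∀ u v, H u v = s u * (starRingEnd ℂ) (s v) *
          (if (u ∈ A ∧ v ∈ B) ∨ (u ∈ B ∧ v ∈ C) ∨ (u ∈ C ∧ v ∈ A) then Complex.I
           else if (u ∈ B ∧ v ∈ A) ∨ (u ∈ C ∧ v ∈ B) ∨ (u ∈ A ∧ v ∈ C) then -Complex.I
           else 0)) ∧
        ρ ^ 2 = (A.card * B.card + B.card * C.card + A.card * C.card : ℝ))) := by
  obtain ⟨-, hdiag, hent⟩ := hH
  have hconj : ∀ p q, starRingEnd ℂ (H p q) = H q p := fun p q => hHerm.apply q p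
  obtain ⟨a, b, hab⟩ : ∃ a b, H a b ≠ 0 := by
    by_contra! h
    have : H = 0 := Matrix.ext h
    simp [this] at hrank
  have hunit : H a b * starRingEnd ℂ (H a b) = 1 := by
    have := hent a b
    simp only [Set.mem_insert_iff, Set.mem_singleton_iff] at this
    rcases this with h | h | h | h <;> simp_all
  have hdec := apply_eq_of_rank_le_two hHerm hdiag hrank.le hunit
  set x : V → ℂ := fun u => H u a with hxdef
  set y : V → ℂ := fun u => starRingEnd ℂ (H a b) * H u b with hydef
  have hx : ∀ u, x u ∈ ({0, 1, -1, I, -I} : Set ℂ) := by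
    intro u
    have := hent u a
    simp only [Set.mem_insert_iff, Set.mem_singleton_iff] at this ⊢
    tauto
  have hy : ∀ u, y u ∈ ({0, 1, -1, I, -I} : Set ℂ) := by
    intro u
    have h1 := hent a b
    have h2 := hent u b
    simp only [Set.mem_insert_iff, Set.mem_singleton_iff, hydef] at h1 h2 ⊢
    rcases h1 with h1 | h1 | h1 | h1 <;> rcases h2 with h2 | h2 | h2 | h2 <;> simp [h1, h2]
  have hH : ∀ u v, H u v = x u * starRingEnd ℂ (y v) + y u * starRingEnd ℂ (x v) := hdec
  have hxa : x a = 0 := hdiag a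
  have hya : y a ≠ 0 := by simp [hydef, hab]
  have hxb : x b ≠ 0 := by
    have : H b a ≠ 0 := by rw [← hconj a b]; simpa using hab
    exact this
  have hyb : y b = 0 := by simp [hydef, hdiag]
  clear_value x y
  have hcls : ∀ u, x u ≠ 0 → y u ≠ 0 → y u = I * x u ∨ y u = -I * x u := by
    intro u hxu hyu
    have h0 := hH u u
    rw [hdiag] at h0
    have h1 := hx u
    have h2 := hy u
    simp only [Set.mem_insert_iff, Set.mem_singleton_iff] at h1 h2
    rcases h1 with h1 | h1 | h1 | h1 | h1 <;> rcases h2 with h2 | h2 | h2 | h2 | h2 <;>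
      first
      | (simp [h1, h2] at hxu hyu ⊢; done)
      | (rw [h1, h2] at h0; norm_num [Complex.ext_iff] at h0)
  have hone : (∀ u, x u ≠ 0 → y u ≠ 0 → y u = I * x u) ∨
      (∀ u, x u ≠ 0 → y u ≠ 0 → y u = -I * x u) := by
    by_contra! h
    obtain ⟨⟨u, hxu, hyu, hu⟩, v, hxv, hyv, hv⟩ := h
    have hu := (hcls u hxu hyu).resolve_left hu
    have hv := (hcls v hxv hyv).resolve_right hv
    have h0 : H u v = -2 * I * (x u * starRingEnd ℂ (x v)) := by
      rw [hH, hu, hv]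
      simp only [map_mul, conj_I]
      ring
    have hn : ∀ z ∈ ({0, 1, -1, I, -I} : Set ℂ), z ≠ 0 → ‖z‖ = 1 := by
      intro z hz hz0
      simp only [Set.mem_insert_iff, Set.mem_singleton_iff] at hz
      rcases hz with rfl | rfl | rfl | rfl | rfl <;> simp at hz0 ⊢
    have h2 : ‖H u v‖ = 2 := by
      rw [h0]
      simp [hn _ (hx u) hxu, hn _ (hx v) hxv]
    have h3 := hent u v
    simp only [Set.mem_insert_iff, Set.mem_singleton_iff] at h3
    rcases h3 with h | h | h | h <;> norm_num [h] at h2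
  have key := hone.elim
    (fun h => exists_switching hx hy hH h ⟨a, hxa, hya⟩ ⟨b, hxb, hyb⟩)
    (fun h => exists_switching hy hx (fun u v => (hH u v).trans (add_comm _ _))
      (fun u hyu hxu => by rw [h u hxu hyu, ← mul_assoc]; simp)
      ⟨b, hyb, hxb⟩ ⟨a, hya, hxa⟩)
  have htr : H.trace = 0 := by simp [Matrix.trace, hdiag]
  have htr2 := trace_mul_self_of_rank_eq_two hHerm htr hrank
  rw [← hρ] at htr2
  have htr3 : (H * H).trace = ∑ u, ∑ v, H u v * starRingEnd ℂ (H u v) := by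
    simp [Matrix.trace, Matrix.mul_apply, hconj]
  obtain ⟨s, hs, A, B, C, T, hdisj, hunion, hA, hB, h⟩ := key
  refine ⟨s, hs, A, B, C, T, hdisj, hunion, hA, hB, ?_⟩
  obtain ⟨hAB, hAC, -, hBC, -, -⟩ := hdisj
  have hss : ∀ u, s u * starRingEnd ℂ (s u) = 1 := by
    intro u
    have := hs u
    simp only [Set.mem_insert_iff, Set.mem_singleton_iff] at this
    rcases this with h | h | h | h <;> simp [h]
  have hnorm : ∀ u v m, H u v = s u * starRingEnd ℂ (s v) * m →
      H u v * starRingEnd ℂ (H u v) = m * starRingEnd ℂ m := by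
    intro u v m h
    rw [h]
    simp only [map_mul, conj_conj]
    linear_combination (s v * starRingEnd ℂ (s v) * m * starRingEnd ℂ m) * hss u +
      (m * starRingEnd ℂ m) * hss v
  have hcount : (∀ u v, H u v * starRingEnd ℂ (H u v) =
      if ((u ∈ A ∧ v ∈ B) ∨ (u ∈ B ∧ v ∈ C) ∨ (u ∈ C ∧ v ∈ A)) ∨
      (u ∈ B ∧ v ∈ A) ∨ (u ∈ C ∧ v ∈ B) ∨ (u ∈ A ∧ v ∈ C) then (1 : ℂ) else 0) →
      ρ ^ 2 = (A.card * B.card + B.card * C.card + A.card * C.card : ℝ) := by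
    intro hc
    simp only [htr3, hc, sum_sum_tripartite hAB hAC hBC] at htr2
    have := mul_left_cancel₀ two_ne_zero htr2
    exact_mod_cast this.symm
  have hmod : ∀ (p q : Prop) [Decidable p] [Decidable q],
      (if p then I else if q then -I else 0) *
        starRingEnd ℂ (if p then I else if q then -I else 0) = if p ∨ q then 1 else 0 := by
    intro p q _ _
    by_cases hp : p <;> by_cases hq : q <;> simp [hp, hq]
  rcases h with ⟨hC, h⟩ | ⟨hC, h⟩
  · refine Or.inl ⟨hC, h, ?_⟩
    rw [hcount fun u v => ?_]
    · simp [hC]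
    · rw [hnorm u v _ (h u v)]
      simp [hC]
  · refine Or.inr ⟨hC, h, hcount fun u v => ?_⟩
    rw [hnorm u v _ (h u v)]
    exact hmod _ _
end

section
/- Let a, b, c ≥ 1 and t ≥ 0 be integers and set n = a + b + c + t. The Hermitian adjacency matrix M of C₃(a,b,c) ∪ t·K₁, defined on (Fin a ⊕ Fin b ⊕ Fin c) ⊕ Fin t by M u v = I when (u,v) lies in (first part)×(second part) ∪ (second part)×(third part) ∪ (third part)×(first part), M u v = -I for the reversed pairs, and M u v = 0 otherwise, satisfies Matrix.rank M = 2 and has characteristic polynomial X^(n-2) · (X² − (a·b + b·c + a·c)). Likewise, for a, b ≥ 1 and t ≥ 0 with n = a + b + t, the adjacency matrix of K_{a,b} ∪ t·K₁ (entry 1 exactly between the two parts of sizes a and b, 0 otherwise) has rank 2 and characteristic polynomial X^(n-2) · (X² − a·b). -/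
open Complex Polynomial

/-- Hermitian adjacency matrix of `C₃(a,b,c) ∪ t·K₁`: the complete tripartite mixed graph
with parts of sizes `a`, `b`, `c`, all arcs directed cyclically, plus `t` isolated vertices. -/
def triM (a b c t : ℕ) :
    Matrix ((Fin a ⊕ Fin b ⊕ Fin c) ⊕ Fin t) ((Fin a ⊕ Fin b ⊕ Fin c) ⊕ Fin t) ℂ :=
  fun u v =>
    match u, v with
    | Sum.inl (Sum.inl _), Sum.inl (Sum.inr (Sum.inl _)) => Complex.I
    | Sum.inl (Sum.inr (Sum.inl _)), Sum.inl (Sum.inr (Sum.inr _)) => Complex.I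
    | Sum.inl (Sum.inr (Sum.inr _)), Sum.inl (Sum.inl _) => Complex.I
    | Sum.inl (Sum.inr (Sum.inl _)), Sum.inl (Sum.inl _) => -Complex.I
    | Sum.inl (Sum.inr (Sum.inr _)), Sum.inl (Sum.inr (Sum.inl _)) => -Complex.I
    | Sum.inl (Sum.inl _), Sum.inl (Sum.inr (Sum.inr _)) => -Complex.I
    | _, _ => 0

/-- Adjacency matrix of `K_{a,b} ∪ t·K₁`. -/
def bipM (a b t : ℕ) :
    Matrix ((Fin a ⊕ Fin b) ⊕ Fin t) ((Fin a ⊕ Fin b) ⊕ Fin t) ℂ :=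
  fun u v =>
    match u, v with
    | Sum.inl (Sum.inl _), Sum.inl (Sum.inr _) => 1
    | Sum.inl (Sum.inr _), Sum.inl (Sum.inl _) => 1
    | _, _ => 0

/-- A product of matrices `P * Q` through `n` with `Q * P` nonsingular has full rank `card n`. -/
theorem Matrix.rank_mul_eq_card_of_det_ne_zero {m n K : Type*} [Fintype m] [Fintype n]
    [DecidableEq n] [Field K] (P : Matrix m n K) (Q : Matrix n m K)
    (h : (Q * P).det ≠ 0) : (P * Q).rank = Fintype.card n := by
  refine le_antisymm ((Matrix.rank_mul_le_left P Q).trans (Matrix.rank_le_card_width P)) ?_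
  have hfull : (Q * (P * Q) * P).rank = Fintype.card n := by
    apply Matrix.rank_of_isUnit
    rw [Matrix.isUnit_iff_isUnit_det, ← Matrix.mul_assoc, Matrix.mul_assoc, Matrix.det_mul]
    exact (isUnit_iff_ne_zero.mpr h).mul (isUnit_iff_ne_zero.mpr h)
  rw [← hfull]
  exact (Matrix.rank_mul_le_left _ _).trans (Matrix.rank_mul_le_right _ _)

/-- Rank and characteristic polynomial of a matrix factoring as `P * Q` through dimension two,
with `Q * P` of trace zero and determinant `-d ≠ 0`. -/
theorem Matrix.rank_and_charpoly_mul_of_trace_eq_zero {m K : Type*} [Fintype m] [DecidableEq m]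
    [Field K] (P : Matrix m (Fin 2) K) (Q : Matrix (Fin 2) m K) {d : K}
    (hm : 2 ≤ Fintype.card m) (htr : (Q * P).trace = 0) (hdet : (Q * P).det = -d) (hd : d ≠ 0) :
    (P * Q).rank = 2 ∧ (P * Q).charpoly = X ^ (Fintype.card m - 2) * (X ^ 2 - C d) := by
  constructor
  · simpa using Matrix.rank_mul_eq_card_of_det_ne_zero P Q (by simpa [hdet] using hd)
  · rw [Matrix.charpoly_mul_comm_of_le P Q (by simpa using hm), Matrix.charpoly_fin_two, htr, hdet]
    simp [sub_eq_add_neg]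

/-- Left factor of `triM`: coordinates of each row in terms of the rows of the first two parts. -/
def triLeft (a b c t : ℕ) : Matrix ((Fin a ⊕ Fin b ⊕ Fin c) ⊕ Fin t) (Fin 2) ℂ :=
  Matrix.of (Sum.elim
    (Sum.elim (fun _ => ![1, 0]) (Sum.elim (fun _ => ![0, 1]) (fun _ => ![-1, -1])))
    (fun _ => 0))

/-- Right factor of `triM`: its rows belonging to the first two parts. -/
def triRight (a b c t : ℕ) : Matrix (Fin 2) ((Fin a ⊕ Fin b ⊕ Fin c) ⊕ Fin t) ℂ :=
  (Matrix.of (Sum.elim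
    (Sum.elim (fun _ => ![0, -I]) (Sum.elim (fun _ => ![I, 0]) (fun _ => ![-I, I])))
    (fun _ => 0)) : Matrix ((Fin a ⊕ Fin b ⊕ Fin c) ⊕ Fin t) (Fin 2) ℂ).transpose

theorem triM_eq_mul (a b c t : ℕ) : triM a b c t = triLeft a b c t * triRight a b c t := by
  ext ((_ | _ | _) | _) ((_ | _ | _) | _) <;>
    simp [triM, triLeft, triRight, Matrix.mul_apply, Fin.sum_univ_two]

theorem triRight_mul_triLeft (a b c t : ℕ) :
    triRight a b c t * triLeft a b c t = !![I * c, I * (b + c); -I * (a + c), -I * c] := by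
  ext i j
  fin_cases i <;> fin_cases j <;>
    simp [triLeft, triRight, Matrix.mul_apply, Fintype.sum_sum_type] <;> ring

/-- Left factor of `bipM`: the indicator vectors of the two parts. -/
def bipLeft (a b t : ℕ) : Matrix ((Fin a ⊕ Fin b) ⊕ Fin t) (Fin 2) ℂ :=
  Matrix.of (Sum.elim (Sum.elim (fun _ => ![1, 0]) (fun _ => ![0, 1])) (fun _ => 0))

/-- Right factor of `bipM`: its rows belonging to the two parts. -/
def bipRight (a b t : ℕ) : Matrix (Fin 2) ((Fin a ⊕ Fin b) ⊕ Fin t) ℂ :=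
  (Matrix.of (Sum.elim (Sum.elim (fun _ => ![0, 1]) (fun _ => ![1, 0])) (fun _ => 0)) :
    Matrix ((Fin a ⊕ Fin b) ⊕ Fin t) (Fin 2) ℂ).transpose

theorem bipM_eq_mul (a b t : ℕ) : bipM a b t = bipLeft a b t * bipRight a b t := by
  ext ((_ | _) | _) ((_ | _) | _) <;>
    simp [bipM, bipLeft, bipRight, Matrix.mul_apply, Fin.sum_univ_two]

theorem bipRight_mul_bipLeft (a b t : ℕ) :
    bipRight a b t * bipLeft a b t = !![0, (b : ℂ); (a : ℂ), 0] := by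
  ext i j
  fin_cases i <;> fin_cases j <;>
    simp [bipLeft, bipRight, Matrix.mul_apply, Fintype.sum_sum_type]

theorem stmt11 :
    (∀ a b c t : ℕ, 1 ≤ a → 1 ≤ b → 1 ≤ c →
      Matrix.rank (triM a b c t) = 2 ∧
      (triM a b c t).charpoly =
        X ^ (a + b + c + t - 2) * (X ^ 2 - C ((a * b + b * c + a * c : ℕ) : ℂ))) ∧
    (∀ a b t : ℕ, 1 ≤ a → 1 ≤ b →
      Matrix.rank (bipM a b t) = 2 ∧
      (bipM a b t).charpoly =
        X ^ (a + b + t - 2) * (X ^ 2 - C ((a * b : ℕ) : ℂ))) := by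
  constructor
  · intro a b c t ha hb hc
    have hcard : Fintype.card ((Fin a ⊕ Fin b ⊕ Fin c) ⊕ Fin t) = a + b + c + t := by
      simp [add_assoc]
    rw [triM_eq_mul, ← hcard]
    apply Matrix.rank_and_charpoly_mul_of_trace_eq_zero
    · omega
    · simp [triRight_mul_triLeft, Matrix.trace_fin_two]
    · rw [triRight_mul_triLeft, Matrix.det_fin_two_of]
      push_cast
      linear_combination (a * b + b * c + a * c : ℂ) * I_mul_I
    · exact Nat.cast_ne_zero.mpr (by positivity)
  · intro a b t ha hb
    have hcard : Fintype.card ((Fin a ⊕ Fin b) ⊕ Fin t) = a + b + t := by simp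
    rw [bipM_eq_mul, ← hcard]
    apply Matrix.rank_and_charpoly_mul_of_trace_eq_zero
    · omega
    · simp [bipRight_mul_bipLeft, Matrix.trace_fin_two]
    · rw [bipRight_mul_bipLeft, Matrix.det_fin_two_of]
      push_cast
      ring
    · exact Nat.cast_ne_zero.mpr (by positivity)
end

section
/- Let H₁ and H₂ be Hermitian adjacency matrices of mixed graphs on Fin n with Matrix.rank H₁ = 2 and Matrix.rank H₂ = 2. Then H₁ and H₂ have the same characteristic polynomial if and only if they have the same number of edges, i.e. if and only if the number of ordered pairs (u,v) with H₁ u v ≠ 0 equals the number of ordered pairs (u,v) with H₂ u v ≠ 0. -/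
open Complex

/-- The trace of the square of a Hermitian matrix is the sum of the squares of its eigenvalues. -/
theorem Matrix.IsHermitian.trace_mul_self {V : Type*} [Fintype V] [DecidableEq V]
    {H : Matrix V V ℂ} (hH : H.IsHermitian) :
    (H * H).trace = ∑ i, (hH.eigenvalues i : ℂ) ^ 2 := by
  conv_lhs =>
    rw [hH.spectral_theorem, ← map_mul, Unitary.conjStarAlgAut_apply, Matrix.trace_mul_cycle]
  simp [Matrix.diagonal_mul_diagonal, Matrix.trace_diagonal, pow_two]

namespace IsHermAdj

variable {V : Type*} [Fintype V] {H : Matrix V V ℂ}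

/-- The trace of the square counts the ordered pairs of adjacent vertices. -/
theorem trace_mul_self (h : IsHermAdj H) :
    (H * H).trace = ((Finset.univ.filter fun p : V × V => H p.1 p.2 ≠ 0).card : ℂ) := by
  rw [Finset.card_filter, Fintype.sum_prod_type]
  push_cast
  simp only [Matrix.trace, Matrix.diag_apply, Matrix.mul_apply]
  refine Finset.sum_congr rfl fun u _ => Finset.sum_congr rfl fun v _ => ?_
  rw [← h.1.apply v u]
  obtain h0 | h0 | h0 | h0 := h.2.2 u v <;> simp_all

/-- The characteristic polynomial of a rank two mixed graph is determined by its order and its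
number of edges. -/
theorem charpoly_eq_of_rank_eq_two [DecidableEq V] (h : IsHermAdj H) (hr : H.rank = 2) :
    H.charpoly = Polynomial.X ^ (Fintype.card V - 2) * (Polynomial.X ^ 2 - Polynomial.C
      (((Finset.univ.filter fun p : V × V => H p.1 p.2 ≠ 0).card : ℂ) / 2)) := by
  rw [← h.trace_mul_self, h.1.trace_mul_self]
  have hchar : H.charpoly = ∏ k, (Polynomial.X - Polynomial.C (h.1.eigenvalues k : ℂ)) :=
    h.1.charpoly_eq
  have htr : ∑ i, (h.1.eigenvalues i : ℂ) = 0 := by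
    have := h.1.trace_eq_sum_eigenvalues
    simpa [Matrix.trace, h.2.1] using this.symm
  have hcard := h.1.rank_eq_card_non_zero_eigs
  rw [hr, Fintype.card_subtype] at hcard
  obtain ⟨i, j, hij, hS⟩ := Finset.card_eq_two.mp hcard.symm
  have hz : ∀ k ∉ ({i, j} : Finset V), h.1.eigenvalues k = 0 := fun k hk => by
    simpa [← hS] using hk
  rw [← Finset.sum_subset (Finset.subset_univ {i, j}) fun k _ hk => by simp [hz k hk],
    Finset.sum_pair hij] at htr ⊢
  have hrest : ∏ k ∈ ({i, j} : Finset V)ᶜ,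
      (Polynomial.X - Polynomial.C (h.1.eigenvalues k : ℂ)) =
        Polynomial.X ^ (Fintype.card V - 2) := by
    rw [Finset.prod_congr rfl fun k hk => by rw [hz k (Finset.mem_compl.mp hk)]]
    rw [Finset.prod_const, Finset.card_compl, Finset.card_pair hij]
    simp
  have hj : (h.1.eigenvalues j : ℂ) = -h.1.eigenvalues i := by linear_combination htr
  have hsq : ((h.1.eigenvalues i : ℂ) ^ 2 + (h.1.eigenvalues j : ℂ) ^ 2) / 2 =
      (h.1.eigenvalues i : ℂ) ^ 2 := by rw [hj]; ring
  rw [hchar, ← Finset.prod_compl_mul_prod ({i, j} : Finset V), hrest, Finset.prod_pair hij, hsq,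
    hj, Polynomial.C_neg, Polynomial.C_pow]
  ring

end IsHermAdj

theorem stmt12 {n : ℕ} (H₁ H₂ : Matrix (Fin n) (Fin n) ℂ)
    (h₁ : IsHermAdj H₁) (h₂ : IsHermAdj H₂)
    (hr₁ : Matrix.rank H₁ = 2) (hr₂ : Matrix.rank H₂ = 2) :
    H₁.charpoly = H₂.charpoly ↔
      (Finset.univ.filter fun p : Fin n × Fin n => H₁ p.1 p.2 ≠ 0).card =
      (Finset.univ.filter fun p : Fin n × Fin n => H₂ p.1 p.2 ≠ 0).card := by
  rw [h₁.charpoly_eq_of_rank_eq_two hr₁, h₂.charpoly_eq_of_rank_eq_two hr₂,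
    mul_right_inj' (pow_ne_zero _ Polynomial.X_ne_zero), sub_right_inj, Polynomial.C_inj,
    div_left_inj' two_ne_zero, Nat.cast_inj]
end

section
/- The set of natural numbers n ≥ 1 such that the adjacency matrix of the complete bipartite graph K_{n,n} (on a vertex type of size 2n) is NOT determined by its Hermitian spectrum is infinite: for infinitely many n there exists a Hermitian adjacency matrix of a mixed graph on 2n vertices that has the same characteristic polynomial as the adjacency matrix of K_{n,n} but is not switching equivalent to it under any relabeling of the vertices. -/
open Complex

/-- `M` is determined by its Hermitian spectrum: every Hermitian adjacency matrix on the
same vertex type with the same characteristic polynomial is, after relabeling the vertices,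
switching equivalent to `M` (possibly composed with taking the converse). -/
def IsDHS {V : Type*} [Fintype V] [DecidableEq V] (M : Matrix V V ℂ) : Prop :=
  ∀ H : Matrix V V ℂ, IsHermAdj H → H.charpoly = M.charpoly →
    ∃ σ : Equiv.Perm V, ∃ s : V → ℂ,
      (∀ v, s v ∈ ({1, -1, Complex.I, -Complex.I} : Set ℂ)) ∧
      ((∀ u v, H u v = s u * (starRingEnd ℂ) (s v) * M (σ u) (σ v)) ∨
       (∀ u v, H u v = s u * (starRingEnd ℂ) (s v) * (starRingEnd ℂ) (M (σ u) (σ v))))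

/-- Adjacency matrix of the complete bipartite graph `K_{n,n}` on `2n` vertices. -/
def Knn (n : ℕ) : Matrix (Fin n ⊕ Fin n) (Fin n ⊕ Fin n) ℂ :=
  fun u v =>
    match u, v with
    | Sum.inl _, Sum.inr _ => 1
    | Sum.inr _, Sum.inl _ => 1
    | _, _ => 0

open Polynomial in
/-- Blowing up a matrix along `f` gives, up to zero eigenvalues, the spectrum of its quotient
matrix, whose columns are weighted by the sizes of the fibres of `f`. -/
theorem charpoly_submatrix_fiber {R V W : Type*} [CommRing R] [Fintype V] [DecidableEq V]
    [Fintype W] [DecidableEq W] (T : Matrix W W R) (f : V → W) :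
    X ^ Fintype.card W * (T.submatrix f f).charpoly =
      X ^ Fintype.card V *
        (T * Matrix.diagonal fun i => ((Fintype.card {v // f v = i} : ℕ) : R)).charpoly := by
  have h_factor : T.submatrix f f =
      (1 : Matrix W W R).submatrix f id * T.submatrix id f := by
    rw [← Matrix.submatrix_mul _ _ _ _ _ Function.bijective_id, one_mul]
  have h_quotient : T.submatrix id f * (1 : Matrix W W R).submatrix f id =
      T * Matrix.diagonal fun i => ((Fintype.card {v // f v = i} : ℕ) : R) := by
    ext i j
    rw [Matrix.mul_diagonal, Matrix.mul_apply]
    simp only [Matrix.submatrix_apply, id, Matrix.one_apply, mul_ite, mul_one, mul_zero]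
    rw [← Finset.sum_filter, Finset.sum_congr rfl (g := fun _ => T i j)
      (fun v hv => by rw [(Finset.mem_filter.1 hv).2]), Finset.sum_const, nsmul_eq_mul, mul_comm,
      Fintype.card_subtype]
  rw [h_factor, ← h_quotient]
  exact Matrix.charpoly_mul_comm' _ _

/-- The Hermitian adjacency matrix of a mixed triangle of weight `I`. -/
def mixedTriangle : Matrix (Fin 3) (Fin 3) ℂ :=
  !![0, 1, -I; 1, 0, 1; I, 1, 0]

theorem isHermAdj_mixedTriangle : IsHermAdj mixedTriangle := by
  refine ⟨?_, ?_, ?_⟩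
  · ext i j
    fin_cases i <;> fin_cases j <;> simp [mixedTriangle]
  · intro i
    fin_cases i <;> simp [mixedTriangle]
  · intro i j
    fin_cases i <;> fin_cases j <;> simp [mixedTriangle]

theorem IsHermAdj.submatrix {V W : Type*} [Fintype V] [Fintype W] {T : Matrix W W ℂ}
    (hT : IsHermAdj T) (f : V → W) : IsHermAdj (T.submatrix f f) :=
  ⟨hT.1.submatrix f, fun v => hT.2.1 (f v), fun u v => hT.2.2 (f u) (f v)⟩

/-- The blow-up of the mixed triangle with parts of sizes `t`, `t` and `4 * t` is cospectral
with `Knn (3 * t)`. -/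
theorem charpoly_mixedTriangle_submatrix (t : ℕ) (f : Fin (3 * t) ⊕ Fin (3 * t) → Fin 3)
    (hf : ∀ i, Fintype.card {v // f v = i} = ![t, t, 4 * t] i) :
    (mixedTriangle.submatrix f f).charpoly = (Knn (3 * t)).charpoly := by
  have h_triangle := charpoly_submatrix_fiber mixedTriangle f
  let g : Fin (3 * t) ⊕ Fin (3 * t) → Fin 2 := Sum.elim (fun _ => 0) (fun _ => 1)
  have hg : ∀ i, Fintype.card {v // g v = i} = 3 * t := by
    intro i
    rw [Fintype.card_subtype, Finset.card_filter, Fintype.sum_sum_type]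
    fin_cases i <;> simp [g]
  have h_Knn : Knn (3 * t) = (!![0, 1; 1, 0] : Matrix (Fin 2) (Fin 2) ℂ).submatrix g g := by
    ext u v
    rcases u with u | u <;> rcases v with v | v <;> simp [Knn, g]
  have h_bipartite := charpoly_submatrix_fiber (!![0, 1; 1, 0] : Matrix (Fin 2) (Fin 2) ℂ) g
  rw [← h_Knn] at h_bipartite
  simp only [hf, hg, Fintype.card_fin] at h_triangle h_bipartite
  have h_nine : (Polynomial.C 9 : Polynomial ℂ) = 9 := rfl
  have h_cubic : (mixedTriangle * Matrix.diagonal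
      fun i => ((![t, t, 4 * t] i : ℕ) : ℂ)).charpoly =
        Polynomial.X * (Polynomial.X ^ 2 - Polynomial.C (9 * (t : ℂ) ^ 2)) := by
    have h_four : (Polynomial.C 4 : Polynomial ℂ) = 4 := rfl
    have hI : (Polynomial.C I : Polynomial ℂ) ^ 2 = -1 := by
      rw [← Polynomial.C_pow, I_sq]; simp
    rw [Matrix.charpoly, Matrix.det_fin_three]
    simp only [Matrix.charmatrix_apply, Matrix.mul_diagonal]
    simp [mixedTriangle, h_nine, h_four]
    linear_combination (4 * Polynomial.X * (t : Polynomial ℂ) ^ 2) * hI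
  have h_quadratic : ((!![0, 1; 1, 0] : Matrix (Fin 2) (Fin 2) ℂ) * Matrix.diagonal
      fun _ => ((3 * t : ℕ) : ℂ)).charpoly =
        Polynomial.X ^ 2 - Polynomial.C (9 * (t : ℂ) ^ 2) := by
    rw [Matrix.charpoly, Matrix.det_fin_two]
    have h_three : (Polynomial.C 3 : Polynomial ℂ) = 3 := rfl
    simp only [Matrix.charmatrix_apply, Matrix.mul_diagonal]
    simp [h_nine, h_three]
    ring
  rw [h_cubic] at h_triangle
  rw [h_quadratic] at h_bipartite
  refine mul_left_cancel₀ (pow_ne_zero 3 (Polynomial.X_ne_zero (R := ℂ))) ?_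
  linear_combination h_triangle - Polynomial.X * h_bipartite

/-- Among any three vertices of `K_{n,n}`, two lie in the same part. -/
theorem Knn_triangle_free {n : ℕ} (u v w : Fin n ⊕ Fin n) :
    Knn n u v = 0 ∨ Knn n v w = 0 ∨ Knn n u w = 0 := by
  rcases u with u | u <;> rcases v with v | v <;> rcases w with w | w <;> simp [Knn]

theorem not_isDHS_Knn_three_mul {t : ℕ} (ht : 1 ≤ t) : ¬ IsDHS (Knn (3 * t)) := by
  intro h
  have e : (Fin (3 * t) ⊕ Fin (3 * t)) ≃ Σ i : Fin 3, Fin (![t, t, 4 * t] i) :=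
    Fintype.equivOfCardEq (by simp [Fin.sum_univ_three]; ring)
  have h_fiber : ∀ i, Fintype.card {v // (e v).1 = i} = ![t, t, 4 * t] i := by
    intro i
    rw [← Fintype.card_fin (![t, t, 4 * t] i)]
    exact Fintype.card_congr ((e.subtypeEquiv fun _ => Iff.rfl).trans
      (Equiv.sigmaSubtype i))
  obtain ⟨σ, s, -, hs⟩ := h _ (isHermAdj_mixedTriangle.submatrix fun v => (e v).1)
    (charpoly_mixedTriangle_submatrix t _ h_fiber)
  have h_zero : ∀ u v, Knn (3 * t) (σ u) (σ v) = 0 → mixedTriangle (e u).1 (e v).1 = 0 := by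
    intro u v huv
    rcases hs with hs | hs <;> simpa [huv] using hs u v
  have h_surj : ∀ i, ∃ v, (e v).1 = i := by
    intro i
    have h_pos : 0 < ![t, t, 4 * t] i := by fin_cases i <;> simp <;> omega
    exact ⟨e.symm ⟨i, 0, h_pos⟩, by simp⟩
  obtain ⟨a, ha⟩ := h_surj 0
  obtain ⟨b, hb⟩ := h_surj 1
  obtain ⟨c, hc⟩ := h_surj 2
  rcases Knn_triangle_free (σ a) (σ b) (σ c) with h0 | h0 | h0 <;>
    simpa [ha, hb, hc, mixedTriangle] using h_zero _ _ h0

theorem stmt13 : {n : ℕ | 1 ≤ n ∧ ¬ IsDHS (Knn n)}.Infinite := by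
  refine Set.infinite_of_injective_forall_mem (f := fun t : ℕ => 3 * (t + 1)) ?_ ?_
  · intro a b hab
    simpa using hab
  · intro t
    exact ⟨by omega, not_isDHS_Knn_three_mul (by omega)⟩
end

section
/- For every integer n ≥ 1, the Hermitian adjacency matrices of the digraphs C₃(n,n,n) and C₃(n,n,n+1) are determined by their Hermitian spectrum, and for every integer n ≥ 2 the Hermitian adjacency matrix of C₃(n−1,n,n) is determined by its Hermitian spectrum. -/
open Complex

/-- Hermitian adjacency matrix of `C₃(x,y,z)`: the complete tripartite mixed graph with
parts of sizes `x`, `y`, `z` and all arcs directed cyclically. -/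
def C3M (x y z : ℕ) : Matrix (Fin x ⊕ Fin y ⊕ Fin z) (Fin x ⊕ Fin y ⊕ Fin z) ℂ :=
  fun u v =>
    match u, v with
    | Sum.inl _, Sum.inr (Sum.inl _) => Complex.I
    | Sum.inr (Sum.inl _), Sum.inr (Sum.inr _) => Complex.I
    | Sum.inr (Sum.inr _), Sum.inl _ => Complex.I
    | Sum.inr (Sum.inl _), Sum.inl _ => -Complex.I
    | Sum.inr (Sum.inr _), Sum.inr (Sum.inl _) => -Complex.I
    | Sum.inl _, Sum.inr (Sum.inr _) => -Complex.I
    | _, _ => 0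

namespace Matrix

theorem det_submatrix_eq_zero_of_rank_lt {V : Type*} [Fintype V] {A : Matrix V V ℂ}
    {k : ℕ} (hA : A.rank < k) (r c : Fin k → V) : (A.submatrix r c).det = 0 := by
  by_contra h
  have hu : IsUnit (A.submatrix r c) := (isUnit_iff_isUnit_det _).2 (isUnit_iff_ne_zero.2 h)
  have h1 := rank_of_isUnit _ hu
  have h2 := A.rank_submatrix_le r c
  simp only [Fintype.card_fin] at h1
  omega

variable {V : Type*} [Fintype V] [DecidableEq V]

theorem IsHermitian.trace_mul_self_eq_sum_eigenvalues_sq {A : Matrix V V ℂ}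
    (hA : A.IsHermitian) : (A * A).trace = ∑ i, (hA.eigenvalues i : ℂ) ^ 2 := by
  have h : A * A = Unitary.conjStarAlgAut ℂ _ hA.eigenvectorUnitary
      (diagonal (RCLike.ofReal ∘ hA.eigenvalues) * diagonal (RCLike.ofReal ∘ hA.eigenvalues)) := by
    rw [map_mul, ← hA.spectral_theorem]
  rw [h, Unitary.conjStarAlgAut_apply, trace_mul_comm, ← mul_assoc]
  simp [trace, diagonal_mul_diagonal, sq]

theorem IsHermitian.trace_mul_self_eq_of_charpoly_eq {A B : Matrix V V ℂ}
    (hA : A.IsHermitian) (hB : B.IsHermitian) (h : A.charpoly = B.charpoly) :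
    (A * A).trace = (B * B).trace := by
  rw [hA.trace_mul_self_eq_sum_eigenvalues_sq, hB.trace_mul_self_eq_sum_eigenvalues_sq,
    (hA.eigenvalues_eq_eigenvalues_iff hB).2 h]

theorem IsHermitian.rank_eq_of_charpoly_eq {A B : Matrix V V ℂ}
    (hA : A.IsHermitian) (hB : B.IsHermitian) (h : A.charpoly = B.charpoly) :
    A.rank = B.rank := by
  rw [hA.rank_eq_card_non_zero_eigs, hB.rank_eq_card_non_zero_eigs,
    (hA.eigenvalues_eq_eigenvalues_iff hB).2 h]

end Matrix

theorem IsHermAdj.pow_four_eq_one {V : Type*} [Fintype V] {H : Matrix V V ℂ} (hH : IsHermAdj H)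
    {u v : V} (h : H u v ≠ 0) : H u v ^ 4 = 1 := by
  have I4 : I ^ 4 = 1 := Complex.I_pow_four
  rcases hH.2.2 u v with h' | h' | h' | h'
  · exact absurd h' h
  all_goals rw [h']
  · simp
  · exact I4
  · rw [neg_pow, I4]; norm_num

theorem mem_fourth_roots_of_pow_four_eq_one {z : ℂ} (hz : z ^ 4 = 1) :
    z ∈ ({1, -1, I, -I} : Set ℂ) := by
  have : (z - 1) * ((z + 1) * ((z - I) * (z + I))) = 0 := by
    linear_combination hz + (1 - z ^ 2) * Complex.I_sq
  rcases mul_eq_zero.1 this with h | h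
  · left; linear_combination h
  rcases mul_eq_zero.1 h with h | h
  · right; left; linear_combination h
  rcases mul_eq_zero.1 h with h | h
  · right; right; left; linear_combination h
  · right; right; right; show z = -I; linear_combination h

theorem mul_conj_eq_one_of_pow_four_eq_one {z : ℂ} (hz : z ^ 4 = 1) :
    z * (starRingEnd ℂ) z = 1 := by
  rcases mem_fourth_roots_of_pow_four_eq_one hz with h | h | h | h <;> rw [h] <;> simp

/-- In a Hermitian adjacency matrix of rank at most two, any nonzero entry determines the whole
matrix from its two rows. -/
theorem IsHermAdj.entry_eq_of_rank_le_two {V : Type*} [Fintype V] [DecidableEq V]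
    {H : Matrix V V ℂ} (hH : IsHermAdj H) (hr : H.rank ≤ 2) {u v : V} (huv : H u v ≠ 0) (w x : V) :
    H w x = H u v * H w u * (starRingEnd ℂ) (H x v)
      + (starRingEnd ℂ) (H u v) * H w v * (starRingEnd ℂ) (H x u) := by
  have hd := Matrix.det_submatrix_eq_zero_of_rank_lt (k := 3) (by omega : H.rank < 3)
    ![u, v, w] ![u, v, x]
  have h1 := mul_conj_eq_one_of_pow_four_eq_one (hH.pow_four_eq_one huv)
  have hvu : H v u = (starRingEnd ℂ) (H u v) := (hH.1.apply v u).symm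
  have hux : H u x = (starRingEnd ℂ) (H x u) := (hH.1.apply u x).symm
  have hvx : H v x = (starRingEnd ℂ) (H x v) := (hH.1.apply v x).symm
  rw [Matrix.det_fin_three] at hd
  simp [hH.2.1, hvu, hux, hvx] at hd
  linear_combination (-1 : ℂ) * hd - H w x * h1

/-- The Hermitian adjacency matrix of a cyclic triangle with arc weight `ε`, together with an
isolated vertex `none`. -/
def cyclicTriangle (ε : ℂ) : Option (Fin 3) → Option (Fin 3) → ℂ
  | some i, some j => if j = i + 1 then ε else if i = j + 1 then -ε else 0
  | _, _ => 0

theorem IsHermAdj.exists_common_ratio {V : Type*} [Fintype V] [DecidableEq V]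
    {H : Matrix V V ℂ} (hH : IsHermAdj H) (hr : H.rank ≤ 2) {u v : V} (huv : H u v ≠ 0) :
    ∃ ε : ℂ, (ε = I ∨ ε = -I) ∧
      ∀ w, H w u ≠ 0 → H w v ≠ 0 → H w v = ε * H u v * H w u := by
  have hI := Complex.I_sq
  have hh := mul_conj_eq_one_of_pow_four_eq_one (hH.pow_four_eq_one huv)
  have key : ∀ w, H w u ≠ 0 → H w v ≠ 0 →
      H w v = I * H u v * H w u ∨ H w v = -I * H u v * H w u := by
    intro w hu hv
    have ha := mul_conj_eq_one_of_pow_four_eq_one (hH.pow_four_eq_one hu)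
    have hb := mul_conj_eq_one_of_pow_four_eq_one (hH.pow_four_eq_one hv)
    have h0 := hH.entry_eq_of_rank_le_two hr huv w w
    rw [hH.2.1] at h0
    have hsq : H w v ^ 2 = -(H u v * H w u) ^ 2 := by
      linear_combination (-(H u v * H w u * H w v)) * h0 - (H u v * H w u) ^ 2 * hb
        - H w v ^ 2 * (H w u * (starRingEnd ℂ) (H w u)) * hh - H w v ^ 2 * ha
    have hp : (H w v - I * H u v * H w u) * (H w v - -I * H u v * H w u) = 0 := by
      linear_combination hsq - (H u v * H w u) ^ 2 * hI
    rcases mul_eq_zero.1 hp with h | h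
    · exact Or.inl (sub_eq_zero.1 h)
    · exact Or.inr (sub_eq_zero.1 h)
  by_cases hex : ∃ w, H w u ≠ 0 ∧ H w v ≠ 0 ∧ H w v = -I * H u v * H w u
  · obtain ⟨x, hxu, hxv, hx⟩ := hex
    refine ⟨-I, Or.inr rfl, fun w hwu hwv => (key w hwu hwv).resolve_left fun hw => ?_⟩
    have h1 := hH.entry_eq_of_rank_le_two hr huv w x
    have h2 : H w x = 2 * I * (H w u * (starRingEnd ℂ) (H x u)) := by
      rw [h1, hw, hx]
      simp only [map_mul, map_neg, conj_I]
      linear_combination (2 * I * H w u * (starRingEnd ℂ) (H x u)) * hh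
    have hwu4 := hH.pow_four_eq_one hwu
    have hxu4 : (starRingEnd ℂ) (H x u) ^ 4 = 1 := by
      rw [← map_pow, hH.pow_four_eq_one hxu, map_one]
    have h16 : H w x ^ 4 = 16 := by
      rw [h2, mul_pow, mul_pow, mul_pow, hwu4, hxu4, Complex.I_pow_four]; norm_num
    have hne : H w x ≠ 0 := by
      intro h; rw [h] at h16; norm_num at h16
    rw [hH.pow_four_eq_one hne] at h16
    norm_num at h16
  · push Not at hex
    exact ⟨I, Or.inl rfl, fun w hwu hwv => (key w hwu hwv).resolve_right (hex w hwu hwv)⟩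

/-- A nonzero Hermitian adjacency matrix of rank at most two is switching equivalent to a blow-up
of a cyclic triangle together with isolated vertices. -/
theorem IsHermAdj.exists_cyclicTriangle_of_rank_le_two {V : Type*} [Fintype V] [DecidableEq V]
    {H : Matrix V V ℂ} (hH : IsHermAdj H) (hr : H.rank ≤ 2) {u v : V} (huv : H u v ≠ 0) :
    ∃ (ε : ℂ) (l : V → Option (Fin 3)) (s : V → ℂ), (ε = I ∨ ε = -I) ∧ (∀ w, s w ^ 4 = 1) ∧
      ∀ w x, H w x = s w * (starRingEnd ℂ) (s x) * cyclicTriangle ε (l w) (l x) := by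
  obtain ⟨ε, hε, hC⟩ := hH.exists_common_ratio hr huv
  have hh4 := hH.pow_four_eq_one huv
  have hh := mul_conj_eq_one_of_pow_four_eq_one hh4
  have hε2 : ε ^ 2 = -1 := by rcases hε with rfl | rfl <;> simp
  have hεc : (starRingEnd ℂ) ε = -ε := by rcases hε with rfl | rfl <;> simp
  have hε4 : ε ^ 4 = 1 := by linear_combination (ε ^ 2 - 1) * hε2
  have hcl : ∀ w, ∃ (o : Option (Fin 3)) (t : ℂ), t ^ 4 = 1 ∧
      ((o = none ∧ H w u = 0 ∧ H w v = 0) ∨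
       (o = some 0 ∧ H w u = 0 ∧ H w v = ε * t) ∨
       (o = some 1 ∧ H w u = (starRingEnd ℂ) (H u v) * t ∧ H w v = 0) ∨
       (o = some 2 ∧ H w u = -((starRingEnd ℂ) (H u v) * t) ∧ H w v = -(ε * t))) := by
    intro w
    by_cases hu : H w u = 0 <;> by_cases hv : H w v = 0
    · exact ⟨none, 1, by simp, Or.inl ⟨rfl, hu, hv⟩⟩
    · refine ⟨some 0, -ε * H w v, ?_, Or.inr (Or.inl ⟨rfl, hu, ?_⟩)⟩
      · rw [mul_pow, hH.pow_four_eq_one hv, neg_pow, hε4]; norm_num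
      · linear_combination H w v * hε2
    · refine ⟨some 1, H u v * H w u, ?_, Or.inr (Or.inr (Or.inl ⟨rfl, ?_, hv⟩))⟩
      · rw [mul_pow, hH.pow_four_eq_one hu, hh4, one_mul]
      · linear_combination (-H w u) * hh
    · refine ⟨some 2, -(H u v * H w u), ?_, Or.inr (Or.inr (Or.inr ⟨rfl, ?_, ?_⟩))⟩
      · rw [neg_pow, mul_pow, hH.pow_four_eq_one hu, hh4]; norm_num
      · linear_combination (-H w u) * hh
      · linear_combination hC w hu hv
  choose l s hs hl using hcl
  refine ⟨ε, l, s, hε, hs, fun w x => ?_⟩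
  rw [hH.entry_eq_of_rank_le_two hr huv w x]
  rcases hl w with ⟨h1, h2, h3⟩ | ⟨h1, h2, h3⟩ | ⟨h1, h2, h3⟩ | ⟨h1, h2, h3⟩ <;>
  rcases hl x with ⟨k1, k2, k3⟩ | ⟨k1, k2, k3⟩ | ⟨k1, k2, k3⟩ | ⟨k1, k2, k3⟩ <;>
  rw [h1, h2, h3, k1, k2, k3] <;>
  simp [cyclicTriangle, hεc] <;>
  first
  | linear_combination (ε * s w * (starRingEnd ℂ) (s x)) * hh
  | linear_combination (-ε * s w * (starRingEnd ℂ) (s x)) * hh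
  | ring

theorem sum_sum_comp_eq {V W : Type*} [Fintype V] [Fintype W] [DecidableEq W] (l : V → W)
    (f : W → W → ℂ) :
    ∑ w, ∑ x, f (l w) (l x) = ∑ i, ∑ j,
      (Fintype.card {w // l w = i} : ℂ) * (Fintype.card {w // l w = j} : ℂ) * f i j := by
  have h1 : ∀ g : W → ℂ, ∑ w, g (l w) = ∑ i, (Fintype.card {w // l w = i} : ℂ) * g i := by
    intro g
    rw [← Finset.sum_fiberwise Finset.univ l]
    refine Finset.sum_congr rfl fun i _ => ?_
    rw [Finset.sum_congr rfl (g := fun _ => g i) (by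
      intro w hw; rw [(Finset.mem_filter.1 hw).2]), Finset.sum_const, nsmul_eq_mul,
      Fintype.card_subtype]
  rw [h1 fun i => ∑ x, f i (l x)]
  refine Finset.sum_congr rfl fun i _ => ?_
  rw [h1, Finset.mul_sum]
  exact Finset.sum_congr rfl fun j _ => by ring

/-- The trace of the square of a blow-up of a cyclic triangle counts every edge twice. -/
theorem trace_mul_self_of_eq_cyclicTriangle {V : Type*} [Fintype V] {H : Matrix V V ℂ}
    {ε : ℂ} (hε : ε = I ∨ ε = -I) {l : V → Option (Fin 3)} {s : V → ℂ} (hs : ∀ w, s w ^ 4 = 1)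
    (h : ∀ w x, H w x = s w * (starRingEnd ℂ) (s x) * cyclicTriangle ε (l w) (l x))
    {a b c : ℕ} (ha : Fintype.card {w // l w = some 0} = a)
    (hb : Fintype.card {w // l w = some 1} = b) (hc : Fintype.card {w // l w = some 2} = c) :
    (H * H).trace = ((2 * (a * b + b * c + c * a) : ℕ) : ℂ) := by
  have hε2 : ε ^ 2 = -1 := by rcases hε with rfl | rfl <;> simp
  have h1 : (H * H).trace =
      ∑ w, ∑ x, cyclicTriangle ε (l w) (l x) * cyclicTriangle ε (l x) (l w) := by
    simp only [Matrix.trace, Matrix.diag_apply, Matrix.mul_apply]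
    refine Finset.sum_congr rfl fun w _ => Finset.sum_congr rfl fun x _ => ?_
    have hw := mul_conj_eq_one_of_pow_four_eq_one (hs w)
    have hx := mul_conj_eq_one_of_pow_four_eq_one (hs x)
    rw [h w x, h x w]
    linear_combination (cyclicTriangle ε (l w) (l x) * cyclicTriangle ε (l x) (l w)) *
      (s x * (starRingEnd ℂ) (s x) * hw + hx)
  rw [h1, sum_sum_comp_eq l fun i j => cyclicTriangle ε i j * cyclicTriangle ε j i]
  simp only [Fintype.sum_option, Fin.sum_univ_three, ha, hb, hc]
  simp [cyclicTriangle]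
  linear_combination (-2 * (a * b + b * c + c * a : ℂ)) * hε2

/-- The index of the part of a vertex of `C₃(x,y,z)`. -/
def C3part (x y z : ℕ) : Fin x ⊕ Fin y ⊕ Fin z → Fin 3
  | Sum.inl _ => 0
  | Sum.inr (Sum.inl _) => 1
  | Sum.inr (Sum.inr _) => 2

theorem C3M_apply (x y z : ℕ) (u v : Fin x ⊕ Fin y ⊕ Fin z) :
    C3M x y z u v = cyclicTriangle I (some (C3part x y z u)) (some (C3part x y z v)) := by
  rcases u with u | u | u <;> rcases v with v | v | v <;> simp [C3M, C3part, cyclicTriangle]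

theorem card_C3part (x y z : ℕ) (i : Fin 3) :
    Fintype.card {u // C3part x y z u = i} = ![x, y, z] i := by
  rw [Fintype.card_subtype, Finset.card_filter, Fintype.sum_sum_type, Fintype.sum_sum_type]
  fin_cases i <;> simp [C3part]

theorem isHermitian_C3M (x y z : ℕ) : (C3M x y z).IsHermitian := by
  ext u v
  rcases u with u | u | u <;> rcases v with v | v | v <;>
    simp [C3M, Matrix.conjTranspose_apply]

theorem rank_C3M_le_two (x y z : ℕ) : (C3M x y z).rank ≤ 2 := by
  have h : C3M x y z = ((!![1, 0; 0, 1; -1, -1] : Matrix (Fin 3) (Fin 2) ℂ) *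
      (!![0, I, -I; -I, 0, I] : Matrix (Fin 2) (Fin 3) ℂ)).submatrix
        (C3part x y z) (C3part x y z) := by
    ext u v
    rcases u with u | u | u <;> rcases v with v | v | v <;>
      simp [C3M, C3part]
  rw [h]
  refine (Matrix.rank_submatrix_le _ _ _).trans ((Matrix.rank_mul_le_left _ _).trans ?_)
  simpa using Matrix.rank_le_card_width (!![1, 0; 0, 1; -1, -1] : Matrix (Fin 3) (Fin 2) ℂ)

/-- A blow-up of a triangle on at most `x + y + z` vertices with as many edges as the balanced
complete tripartite graph with parts `x, y, z` has the same part sizes up to rotation. -/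
theorem exists_rotation_of_edge_count_eq {a b c x y z : ℕ}
    (hpos : 0 < x * y + y * z + z * x) (hN : a + b + c ≤ x + y + z)
    (hE : a * b + b * c + c * a = x * y + y * z + z * x)
    (hb : (x = y ∧ z ≤ y + 1 ∧ y ≤ z + 1) ∨ (y = z ∧ x ≤ y + 1 ∧ y ≤ x + 1)) :
    a + b + c = x + y + z ∧
      ∃ r : Fin 3, ∀ i, ![a, b, c] i = ![x, y, z] (i + r) := by
  have hS : 0 < a + b + c := by
    by_contra! h
    obtain ⟨rfl, rfl, rfl⟩ : a = 0 ∧ b = 0 ∧ c = 0 := by omega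
    omega
  zify at hN hE hb hS
  have hD : ((x : ℤ) - y) ^ 2 + (y - z) ^ 2 + (z - x) ^ 2 ≤ 2 := by
    rcases hb with ⟨h, h1, h2⟩ | ⟨h, h1, h2⟩ <;> rw [h] <;> nlinarith
  have hD' : ((a : ℤ) - b) ^ 2 + (b - c) ^ 2 + (c - a) ^ 2 ≤ 2 := by
    have h2 : ((a : ℤ) + b + c) ^ 2 ≤ (x + y + z) ^ 2 := by gcongr
    linarith only [h2, hD, hE]
  have hT : (a : ℤ) + b + c = x + y + z := by
    by_contra h
    have h1 : (a : ℤ) + b + c + 1 ≤ x + y + z := by omega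
    have h2 : ((a : ℤ) + b + c + 1) ^ 2 ≤ (x + y + z) ^ 2 := by gcongr
    nlinarith only [h2, hD, hE, hS, sq_nonneg ((a : ℤ) - b), sq_nonneg ((b : ℤ) - c),
      sq_nonneg ((c : ℤ) - a)]
  have hDD : ((a : ℤ) - b) ^ 2 + (b - c) ^ 2 + (c - a) ^ 2 =
      ((x : ℤ) - y) ^ 2 + (y - z) ^ 2 + (z - x) ^ 2 := by
    linear_combination 2 * (a + b + c + x + y + z : ℤ) * hT - 6 * hE
  refine ⟨by exact_mod_cast hT, ?_⟩
  have hrot : (a = x ∧ b = y ∧ c = z) ∨ (a = y ∧ b = z ∧ c = x) ∨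
      (a = z ∧ b = x ∧ c = y) := by
    obtain ⟨p, hp⟩ : ∃ p : ℤ, (a : ℤ) = b + p := ⟨a - b, by ring⟩
    obtain ⟨q, hq⟩ : ∃ q : ℤ, (c : ℤ) = b + q := ⟨c - b, by ring⟩
    have hpq : p ^ 2 + q ^ 2 + (q - p) ^ 2 ≤ 2 := by
      rw [hp, hq] at hD'; linarith
    have hp1 : p ≤ 1 := by nlinarith only [hpq, sq_nonneg q, sq_nonneg (q - p)]
    have hp2 : -1 ≤ p := by nlinarith only [hpq, sq_nonneg q, sq_nonneg (q - p)]
    have hq1 : q ≤ 1 := by nlinarith only [hpq, sq_nonneg p, sq_nonneg (q - p)]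
    have hq2 : -1 ≤ q := by nlinarith only [hpq, sq_nonneg p, sq_nonneg (q - p)]
    rcases hb with ⟨h, h1, h2⟩ | ⟨h, h1, h2⟩
    · obtain ⟨d, hd⟩ : ∃ d : ℤ, (z : ℤ) = y + d := ⟨z - y, by ring⟩
      have hd1 : d ≤ 1 := by omega
      have hd2 : -1 ≤ d := by omega
      rw [hp, hq, h, hd] at hDD
      ring_nf at hDD
      interval_cases p <;> interval_cases q <;> interval_cases d <;> omega
    · obtain ⟨d, hd⟩ : ∃ d : ℤ, (x : ℤ) = y + d := ⟨x - y, by ring⟩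
      have hd1 : d ≤ 1 := by omega
      have hd2 : -1 ≤ d := by omega
      rw [hp, hq, ← h, hd] at hDD
      ring_nf at hDD
      interval_cases p <;> interval_cases q <;> interval_cases d <;> omega
  rcases hrot with ⟨rfl, rfl, rfl⟩ | ⟨rfl, rfl, rfl⟩ | ⟨rfl, rfl, rfl⟩
  · exact ⟨0, fun i => by fin_cases i <;> rfl⟩
  · exact ⟨1, fun i => by fin_cases i <;> rfl⟩
  · exact ⟨2, fun i => by fin_cases i <;> rfl⟩

theorem isDHS_C3M {x y z : ℕ} (hpos : 0 < x * y + y * z + z * x)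
    (hb : (x = y ∧ z ≤ y + 1 ∧ y ≤ z + 1) ∨ (y = z ∧ x ≤ y + 1 ∧ y ≤ x + 1)) :
    IsDHS (C3M x y z) := by
  intro H hH hchar
  have hM := isHermitian_C3M x y z
  have hr : H.rank ≤ 2 := (hH.1.rank_eq_of_charpoly_eq hM hchar).trans_le (rank_C3M_le_two x y z)
  have hMtr : (C3M x y z * C3M x y z).trace = ((2 * (x * y + y * z + z * x) : ℕ) : ℂ) :=
    trace_mul_self_of_eq_cyclicTriangle (Or.inl rfl) (l := fun u => some (C3part x y z u))
      (s := fun _ => 1) (by simp) (by simp [C3M_apply])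
      (by simp [card_C3part]) (by simp [card_C3part]) (by simp [card_C3part])
  have htr := hH.1.trace_mul_self_eq_of_charpoly_eq hM hchar
  obtain ⟨u, v, huv⟩ : ∃ u v, H u v ≠ 0 := by
    by_contra! h0
    have : H = 0 := Matrix.ext h0
    rw [this, hMtr, mul_zero, Matrix.trace_zero] at htr
    have := Nat.cast_eq_zero.1 htr.symm
    omega
  obtain ⟨ε, l, s, hε, hs, hl⟩ := hH.exists_cyclicTriangle_of_rank_le_two hr huv
  rw [hMtr, trace_mul_self_of_eq_cyclicTriangle hε hs hl rfl rfl rfl] at htr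
  have hE := Nat.cast_injective htr
  have hcard : ∑ o, Fintype.card {w // l w = o} = x + (y + z) := by
    rw [← Fintype.card_sigma, Fintype.card_congr (Equiv.sigmaFiberEquiv l)]
    simp
  rw [Fintype.sum_option, Fin.sum_univ_three] at hcard
  obtain ⟨hN, r, hrot⟩ := exists_rotation_of_edge_count_eq hpos (by omega)
    (Nat.eq_of_mul_eq_mul_left two_pos hE) hb
  have hnone : Fintype.card {w // l w = none} = 0 := by omega
  have hsome : ∀ w, ∃ i, l w = some i := fun w =>
    Option.ne_none_iff_exists'.1 fun h => (Fintype.card_eq_zero_iff.1 hnone).false ⟨w, h⟩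
  choose k hk using hsome
  have hfib : ∀ c, Fintype.card {w // k w + r = c} =
      Fintype.card {w // C3part x y z w = c} := by
    intro c
    have h1 := hrot (c - r)
    rw [sub_add_cancel] at h1
    rw [card_C3part, ← h1]
    have h2 : ∀ i, ![Fintype.card {w // l w = some 0}, Fintype.card {w // l w = some 1},
        Fintype.card {w // l w = some 2}] i = Fintype.card {w // l w = some i} := by
      intro i; fin_cases i <;> rfl
    rw [h2]
    refine Fintype.card_congr (Equiv.subtypeEquivRight fun w => ?_)
    rw [hk, Option.some_inj, eq_sub_iff_add_eq]
  let σ := Equiv.ofFiberEquiv fun c => Fintype.equivOfCardEq (hfib c)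
  have hσ : ∀ w, C3part x y z (σ w) = k w + r := Equiv.ofFiberEquiv_map _
  have hshift : ∀ w x', cyclicTriangle ε (some (k w + r)) (some (k x' + r)) =
      cyclicTriangle ε (l w) (l x') := by
    intro w x'
    simp only [hk, cyclicTriangle, add_right_comm _ r (1 : Fin 3), add_left_inj]
  refine ⟨σ, s, fun w => mem_fourth_roots_of_pow_four_eq_one (hs w), ?_⟩
  rcases hε with rfl | rfl
  · left
    intro w x'
    rw [C3M_apply, hσ, hσ, hshift, hl]
  · right
    intro w x'
    have hconj : ∀ o p, (starRingEnd ℂ) (cyclicTriangle I o p) = cyclicTriangle (-I) o p := by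
      rintro (_ | i) (_ | j) <;> simp only [cyclicTriangle, map_zero]
      split_ifs <;> simp
    rw [C3M_apply, hσ, hσ, hconj, hshift, hl]

theorem stmt15 :
    (∀ n : ℕ, 1 ≤ n → IsDHS (C3M n n n) ∧ IsDHS (C3M n n (n + 1))) ∧
    (∀ n : ℕ, 2 ≤ n → IsDHS (C3M (n - 1) n n)) := by
  refine ⟨fun n hn => ⟨isDHS_C3M ?_ ?_, isDHS_C3M ?_ ?_⟩, fun n hn => isDHS_C3M ?_ ?_⟩
  · positivity
  · omega
  · positivity
  · omega
  · have : 0 < n * n := by positivity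
    omega
  · omega
end
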